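/- arXiv:1907.02837 — 2 statements merged into one kernel-verified Lean document; each statement's English description precedes it below -/
import Mathlib

section
/- Let Ω ⊂ ℝ^N (N ≥ 2) be a smooth bounded domain, let s, p satisfy (S1), (P1), and let β ∈ C₊(Ω̄) with p(x,x) ≤ β(x) < p_s*(x) for all x ∈ Ω̄. Then (X₀, ‖·‖_{X₀}) is a uniformly convex and reflexive Banach space; in particular it is complete, and its norm is uniformly convex: for every ε ∈ (0,2] there exists δ > 0 such that for all u, v ∈ X₀ with ‖u‖_{X₀} ≤ 1, ‖v‖_{X₀} ≤ 1 and ‖u − v‖_{X₀} ≥ ε one has ‖(u+v)/2‖_{X₀} ≤ 1 − δ. -/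
open MeasureTheory Set Filter ENNReal

noncomputable section

namespace VarOrderChoquard

variable {N : ℕ}

/-- `ℝ^N` with the Euclidean structure. -/
abbrev RN (N : ℕ) := EuclideanSpace ℝ (Fin N)

/-- `Φ⁻` : infimum of a two-variable real function over `ℝ^N × ℝ^N`. -/
def inf2 (f : RN N → RN N → ℝ) : ℝ := sInf {t | ∃ x y, f x y = t}

/-- `Φ⁺` : supremum of a two-variable real function over `ℝ^N × ℝ^N`. -/
def sup2 (f : RN N → RN N → ℝ) : ℝ := sSup {t | ∃ x y, f x y = t}

/-- `Φ⁻` over a subset `D ⊆ ℝ^N`. -/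
def infOn (D : Set (RN N)) (g : RN N → ℝ) : ℝ := sInf (g '' D)

/-- `Φ⁺` over a subset `D ⊆ ℝ^N`. -/
def supOn (D : Set (RN N)) (g : RN N → ℝ) : ℝ := sSup (g '' D)

/-- `C₊(ℝ^N × ℝ^N)` : continuous with `1 < Φ⁻ ≤ Φ⁺ < ∞`. -/
def CPlus2 (f : RN N → RN N → ℝ) : Prop :=
  Continuous (fun z : RN N × RN N => f z.1 z.2) ∧ 1 < inf2 f ∧
    BddAbove {t | ∃ x y, f x y = t}

/-- `C₊(D)` for `D ⊆ ℝ^N`. -/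
def CPlusOn (D : Set (RN N)) (g : RN N → ℝ) : Prop :=
  ContinuousOn g D ∧ 1 < infOn D g ∧ BddAbove (g '' D)

/-- Condition (S1). -/
def S1 (s : RN N → RN N → ℝ) : Prop :=
  Continuous (fun z : RN N × RN N => s z.1 z.2) ∧ (∀ x y, s x y = s y x) ∧
    BddAbove {t | ∃ x y, s x y = t} ∧ 0 < inf2 s ∧ sup2 s < 1

/-- Condition (P1). -/
def P1 (s p : RN N → RN N → ℝ) : Prop :=
  CPlus2 p ∧ (∀ x y, p x y = p y x) ∧ sup2 s * sup2 p < N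

/-- Condition (μ1). -/
def Mu1 (μ : RN N → RN N → ℝ) : Prop :=
  (∀ x y, μ x y = μ y x) ∧ BddAbove {t | ∃ x y, μ x y = t} ∧
    0 < inf2 μ ∧ sup2 μ < N

/-- The critical exponent `p_s*(x) = N p(x,x) / (N - s(x,x) p(x,x))`. -/
def pstar (s p : RN N → RN N → ℝ) (x : RN N) : ℝ :=
  N * p x x / (N - s x x * p x x)

/-- The class `𝓜` : `p(x,x) ≤ r(x)q⁻ ≤ r(x)q⁺ < p_s*(x)` for all `x`. -/
def MemM (s p q : RN N → RN N → ℝ) (r : RN N → ℝ) : Prop :=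
  ∀ x, p x x ≤ r x * inf2 q ∧ r x * inf2 q ≤ r x * sup2 q ∧
    r x * sup2 q < pstar s p x

/-- Variable-exponent modular `∫_U |u/l|^{γ(x)} dx`. -/
def lmodular (U : Set (RN N)) (γ : RN N → ℝ) (u : RN N → ℝ) (l : ℝ) : ℝ≥0∞ :=
  ∫⁻ x in U, ENNReal.ofReal (|u x| / l) ^ γ x

/-- Membership in the variable-exponent Lebesgue space `L^{γ(x)}(U)`. -/
def MemVarLp (U : Set (RN N)) (γ : RN N → ℝ) (u : RN N → ℝ) : Prop :=
  Measurable u ∧ ∃ l, 0 < l ∧ lmodular U γ u l < ⊤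

/-- Luxemburg norm on `L^{γ(x)}(U)`. -/
def luxNorm (U : Set (RN N)) (γ : RN N → ℝ) (u : RN N → ℝ) : ℝ :=
  sInf {l | 0 < l ∧ lmodular U γ u l ≤ 1}

/-- Membership in the classical Lebesgue space `L^t(U)` (constant exponent `t`). -/
def MemCLp (U : Set (RN N)) (t : ℝ) (g : RN N → ℝ) : Prop :=
  Measurable g ∧ (∫⁻ x in U, ENNReal.ofReal |g x| ^ t) < ⊤

/-- The classical `L^t(U)`-norm. -/
def cLpNorm (U : Set (RN N)) (t : ℝ) (g : RN N → ℝ) : ℝ :=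
  (∫⁻ x in U, ENNReal.ofReal |g x| ^ t).toReal ^ (1 / t)

/-- Gagliardo-type modular
`∫_A (|u(x)-u(y)|/l)^{p(x,y)} / |x-y|^{N+s(x,y)p(x,y)} dx dy`. -/
def gmodular (A : Set (RN N × RN N)) (s p : RN N → RN N → ℝ) (u : RN N → ℝ)
    (l : ℝ) : ℝ≥0∞ :=
  ∫⁻ z in A, ENNReal.ofReal (|u z.1 - u z.2| / l) ^ p z.1 z.2 /
    ENNReal.ofReal (dist z.1 z.2) ^ ((N : ℝ) + s z.1 z.2 * p z.1 z.2)

/-- Membership in `W^{s(x,y),β(x),p(x,y)}(U)`. -/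
def MemW (U : Set (RN N)) (s p : RN N → RN N → ℝ) (β : RN N → ℝ)
    (u : RN N → ℝ) : Prop :=
  MemVarLp U β u ∧ ∃ l, 0 < l ∧ gmodular (U ×ˢ U) s p u l < ⊤

/-- The Gagliardo seminorm `[u]_U^{s,p}`. -/
def wSeminorm (U : Set (RN N)) (s p : RN N → RN N → ℝ) (u : RN N → ℝ) : ℝ :=
  sInf {l | 0 < l ∧ gmodular (U ×ˢ U) s p u l < 1}

/-- The norm on `W`. -/
def wNorm (U : Set (RN N)) (s p : RN N → RN N → ℝ) (β : RN N → ℝ)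
    (u : RN N → ℝ) : ℝ :=
  luxNorm U β u + wSeminorm U s p u

/-- `Q = (ℝ^N × ℝ^N) \ (Ωᶜ × Ωᶜ)`. -/
def Qset (Ω : Set (RN N)) : Set (RN N × RN N) := univ \ (Ωᶜ ×ˢ Ωᶜ)

/-- Membership in `X₀`. -/
def MemX0 (Ω : Set (RN N)) (s p : RN N → RN N → ℝ) (β : RN N → ℝ)
    (u : RN N → ℝ) : Prop :=
  Measurable u ∧ MemVarLp Ω β u ∧ (∃ l, 0 < l ∧ gmodular (Qset Ω) s p u l < ⊤) ∧
    (∀ᵐ x, x ∉ Ω → u x = 0)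

/-- The `X₀`-norm. -/
def x0Norm (s p : RN N → RN N → ℝ) (u : RN N → ℝ) : ℝ :=
  sInf {l | 0 < l ∧ gmodular univ s p u l < 1}

/-- The modular `ρ_{X₀}`. -/
def rhoX0 (s p : RN N → RN N → ℝ) (u : RN N → ℝ) : ℝ≥0∞ :=
  gmodular univ s p u 1

/-- Carathéodory function. -/
def Caratheodory (f : RN N → ℝ → ℝ) : Prop :=
  (∀ t, Measurable fun x => f x t) ∧ ∀ x, Continuous fun t => f x t

/-- `F(x,t) = ∫₀ᵗ f(x,τ) dτ`. -/
def Fant (f : RN N → ℝ → ℝ) (x : RN N) (t : ℝ) : ℝ := ∫ τ in (0:ℝ)..t, f x τ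

/-- Growth condition (F1) (with data `M` and `r`). -/
def F1 (Ω : Set (RN N)) (f : RN N → ℝ → ℝ) (M : ℝ) (r : RN N → ℝ) : Prop :=
  0 < M ∧ ∀ x ∈ Ω, ∀ t : ℝ, |f x t| ≤ M * |t| ^ (r x - 1)

/-- Ambrosetti–Rabinowitz type condition (F2) (with data `Θ`). -/
def F2 (Ω : Set (RN N)) (f : RN N → ℝ → ℝ) (Θ : ℝ) : Prop :=
  ∀ᵐ x, x ∈ Ω → ∀ t : ℝ, t ≠ 0 →
    0 < Θ * Fant f x t ∧ Θ * Fant f x t ≤ 2 * (t * f x t)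

/-- The left-hand side pairing
`∫∫ |u(x)-u(y)|^{p-2}(u(x)-u(y))(w(x)-w(y)) / |x-y|^{N+sp} dx dy`. -/
def energyLHS (s p : RN N → RN N → ℝ) (u w : RN N → ℝ) : ℝ :=
  ∫ z : RN N × RN N,
    |u z.1 - u z.2| ^ (p z.1 z.2 - 2) * (u z.1 - u z.2) * (w z.1 - w z.2) /
      dist z.1 z.2 ^ ((N : ℝ) + s z.1 z.2 * p z.1 z.2)

/-- The Choquard right-hand side `∫_Ω ∫_Ω F(x,u(x)) f(y,u(y)) w(y) / |x-y|^μ`. -/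
def choquardRHS (Ω : Set (RN N)) (μ : RN N → RN N → ℝ) (f : RN N → ℝ → ℝ)
    (u w : RN N → ℝ) : ℝ :=
  ∫ x in Ω, ∫ y in Ω, Fant f x (u x) * f y (u y) * w y / dist x y ^ μ x y

/-- The energy functional `J`. -/
def Jfun (Ω : Set (RN N)) (s p μ : RN N → RN N → ℝ) (f : RN N → ℝ → ℝ)
    (u : RN N → ℝ) : ℝ :=
  (∫ z : RN N × RN N,
    |u z.1 - u z.2| ^ p z.1 z.2 /
      (p z.1 z.2 * dist z.1 z.2 ^ ((N : ℝ) + s z.1 z.2 * p z.1 z.2)))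
  - (1/2) * ∫ x in Ω, ∫ y in Ω,
      Fant f x (u x) * Fant f y (u y) / dist x y ^ μ x y

/-- `⟨J'(u), w⟩`. -/
def Jderiv (Ω : Set (RN N)) (s p μ : RN N → RN N → ℝ) (f : RN N → ℝ → ℝ)
    (u w : RN N → ℝ) : ℝ :=
  energyLHS s p u w - choquardRHS Ω μ f u w

/-- The perturbed functional `J_λ`. -/
def Jlam (Ω : Set (RN N)) (s p μ : RN N → RN N → ℝ) (f : RN N → ℝ → ℝ)
    (α : RN N → ℝ) (lam : ℝ) (u : RN N → ℝ) : ℝ :=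
  Jfun Ω s p μ f u - lam * ∫ x in Ω, |u x| ^ α x / α x


/-- A quantitative form of the strict convexity of `t ↦ |t| ^ r`, uniform for `r ∈ [q, P]`,
on pairs whose larger entry is `1`. -/
lemma exists_rpow_clarkson_one {q P κ : ℝ} (hq : 1 < q) (hκ : 0 < κ) :
    ∃ δ : ℝ, 0 < δ ∧ ∀ r ∈ Icc q P, ∀ b ∈ Icc (-1 : ℝ) 1,
      |(1 + b) / 2| ^ r + δ * |(1 - b) / 2| ^ r ≤ (1 + κ * δ) * ((1 + |b| ^ r) / 2) := by
  set F : ℝ × ℝ → ℝ := fun z => (1 + |z.2| ^ z.1) / 2 - |(1 + z.2) / 2| ^ z.1 with hF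
  set G : ℝ × ℝ → ℝ := fun z => |(1 - z.2) / 2| ^ z.1 - κ * ((1 + |z.2| ^ z.1) / 2) with hG
  have hpow : ∀ g : ℝ × ℝ → ℝ, Continuous g →
      ContinuousOn (fun z => |g z| ^ z.1) (Icc q P ×ˢ Icc (-1 : ℝ) 1) := fun g hg =>
    hg.abs.continuousOn.rpow continuous_fst.continuousOn fun z hz =>
      Or.inr (lt_of_lt_of_le (by linarith) hz.1.1)
  have hFc : ContinuousOn F (Icc q P ×ˢ Icc (-1 : ℝ) 1) :=
    ((continuousOn_const.add (hpow _ continuous_snd)).div_const 2).sub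
      (hpow (fun z => (1 + z.2) / 2) (by fun_prop))
  have hGc : ContinuousOn G (Icc q P ×ˢ Icc (-1 : ℝ) 1) :=
    (hpow (fun z => (1 - z.2) / 2) (by fun_prop)).sub
      (continuousOn_const.mul ((continuousOn_const.add (hpow _ continuous_snd)).div_const 2))
  set K : Set (ℝ × ℝ) := (Icc q P ×ˢ Icc (-1 : ℝ) 1) ∩ G ⁻¹' Ici 0 with hK
  have hcomp : IsCompact (Icc q P ×ˢ Icc (-1 : ℝ) 1) := isCompact_Icc.prod isCompact_Icc
  have hKc : IsCompact K := hcomp.of_isClosed_subset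
    (hGc.preimage_isClosed_of_isClosed hcomp.isClosed isClosed_Ici) inter_subset_left
  have hmid : ∀ r b : ℝ, 1 < r → |b| ≤ 1 → |(1 + b) / 2| ^ r ≤ (1 + |b| ^ r) / 2 ∧
      (b ≠ 1 → |(1 + b) / 2| ^ r < (1 + |b| ^ r) / 2) := by
    intro r b hr hb
    have hle : |(1 + b) / 2| ≤ (1 + |b|) / 2 := by
      rw [abs_div, abs_two]
      have := abs_add_le 1 b
      rw [abs_one] at this
      linarith
    have h1 : |(1 + b) / 2| ^ r ≤ ((1 + |b|) / 2) ^ r :=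
      Real.rpow_le_rpow (abs_nonneg _) hle (by linarith)
    have hstrict : |b| ≠ 1 → ((1 + |b|) / 2) ^ r < (1 + |b| ^ r) / 2 := by
      intro hb1
      obtain ⟨-, hconv⟩ := strictConvexOn_rpow hr
      have := hconv (mem_Ici.2 zero_le_one) (mem_Ici.2 (abs_nonneg b)) (Ne.symm hb1)
        (show (0 : ℝ) < 1 / 2 by norm_num) (show (0 : ℝ) < 1 / 2 by norm_num) (by norm_num)
      simp only [smul_eq_mul, Real.one_rpow] at this
      calc ((1 + |b|) / 2) ^ r = (1 / 2 * 1 + 1 / 2 * |b|) ^ r := by ring_nf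
        _ < 1 / 2 * 1 + 1 / 2 * |b| ^ r := this
        _ = _ := by ring
    by_cases hb1 : |b| = 1
    · have h2 : |(1 + b) / 2| ^ r ≤ (1 + |b| ^ r) / 2 := by
        rw [hb1] at h1 ⊢
        simpa using h1
      refine ⟨h2, fun hne => ?_⟩
      have : b = -1 := (abs_eq zero_le_one).1 hb1 |>.resolve_left hne
      subst this
      have hr0 : r ≠ 0 := by linarith
      simp [Real.zero_rpow hr0]
    · exact ⟨h1.trans (hstrict hb1).le, fun _ => h1.trans_lt (hstrict hb1)⟩
  obtain ⟨c, hc, hcF⟩ : ∃ c : ℝ, 0 < c ∧ ∀ z ∈ K, c ≤ F z := by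
    refine hKc.exists_forall_le' (a := 0) (hFc.mono inter_subset_left) fun z hz => ?_
    have hb : |z.2| ≤ 1 := abs_le.2 hz.1.2
    have hr : 1 < z.1 := hq.trans_le hz.1.1.1
    refine sub_pos.2 ((hmid z.1 z.2 hr hb).2 fun h1 => ?_)
    have hG0 : 0 ≤ G z := hz.2
    simp only [hG, h1, sub_self, zero_div, abs_zero, abs_one, Real.one_rpow] at hG0
    rw [Real.zero_rpow (by linarith)] at hG0
    linarith
  refine ⟨c, hc, fun r hr b hb => ?_⟩
  have hb' : |b| ≤ 1 := abs_le.2 hb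
  have hr1 : 1 < r := hq.trans_le hr.1
  have hF0 : 0 ≤ F (r, b) := sub_nonneg.2 (hmid r b hr1 hb').1
  have hG1 : G (r, b) ≤ 1 := by
    have h1 : |(1 - b) / 2| ^ r ≤ 1 := by
      refine Real.rpow_le_one (abs_nonneg _) ?_ (by linarith)
      rw [abs_le]
      constructor <;> linarith [hb.1, hb.2]
    have h2 : 0 ≤ |b| ^ r := by positivity
    have h3 : 0 ≤ κ * ((1 + |b| ^ r) / 2) := by positivity
    simp only [hG]
    linarith
  have key : c * G (r, b) ≤ F (r, b) := by
    by_cases h0 : 0 ≤ G (r, b)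
    · have := hcF (r, b) ⟨⟨hr, hb⟩, h0⟩
      nlinarith
    · push Not at h0
      nlinarith
  simp only [hF, hG] at key
  linarith

/-- A quantitative form of the strict convexity of `t ↦ |t| ^ r`, uniform for `r ∈ [q, P]`. -/
lemma exists_rpow_clarkson {q P κ : ℝ} (hq : 1 < q) (hκ : 0 < κ) :
    ∃ δ : ℝ, 0 < δ ∧ ∀ r ∈ Icc q P, ∀ a b : ℝ,
      |(a + b) / 2| ^ r + δ * |(a - b) / 2| ^ r ≤ (1 + κ * δ) * ((|a| ^ r + |b| ^ r) / 2) := by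
  obtain ⟨δ, hδ, h⟩ := exists_rpow_clarkson_one (P := P) hq hκ
  refine ⟨δ, hδ, fun r hr => ?_⟩
  have hr1 : 1 < r := hq.trans_le hr.1
  have main : ∀ a b : ℝ, |b| ≤ |a| →
      |(a + b) / 2| ^ r + δ * |(a - b) / 2| ^ r ≤ (1 + κ * δ) * ((|a| ^ r + |b| ^ r) / 2) := by
    intro a b hab
    rcases eq_or_ne a 0 with rfl | ha
    · have hb : b = 0 := by simpa using hab
      subst hb
      simp [Real.zero_rpow (show r ≠ 0 by linarith)]
    · have hquot : b / a ∈ Icc (-1 : ℝ) 1 := by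
        rw [mem_Icc, ← abs_le, abs_div]
        exact div_le_one_of_le₀ hab (abs_nonneg a)
      have scale : ∀ t, |a * t| ^ r = |a| ^ r * |t| ^ r := fun t => by
        rw [abs_mul, Real.mul_rpow (abs_nonneg _) (abs_nonneg _)]
      have e1 : (a + b) / 2 = a * ((1 + b / a) / 2) := by field_simp
      have e2 : (a - b) / 2 = a * ((1 - b / a) / 2) := by field_simp
      have e3 : |b| ^ r = |a| ^ r * |b / a| ^ r := by
        rw [← scale]; congr 2; field_simp
      rw [e1, e2, e3, scale, scale]
      have := mul_le_mul_of_nonneg_left (h r hr _ hquot) (show 0 ≤ |a| ^ r by positivity)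
      linarith
  intro a b
  rcases le_total |b| |a| with hab | hab
  · exact main a b hab
  · have := main b a hab
    rwa [add_comm b a, abs_div (b - a), abs_sub_comm b a, ← abs_div,
      add_comm (|b| ^ r)] at this

section VarModular

variable {Z : Type*} [MeasurableSpace Z] {ν : Measure Z} {r : Z → ℝ}

/-- The modular `∫ |f| ^ r dν` with a variable exponent `r`. -/
def varModular (ν : Measure Z) (r f : Z → ℝ) : ℝ≥0∞ :=
  ∫⁻ z, ENNReal.ofReal |f z| ^ r z ∂ν

/-- The Luxemburg functional associated with `varModular`. -/
def varLux (ν : Measure Z) (r f : Z → ℝ) : ℝ :=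
  sInf {l | 0 < l ∧ varModular ν r (fun z => f z / l) < 1}

lemma varModular_le_of_pointwise {f g : Z → ℝ} {C : ℝ≥0∞} (hC : C ≠ ⊤)
    (h : ∀ z, ENNReal.ofReal |f z| ^ r z ≤ C * ENNReal.ofReal |g z| ^ r z) :
    varModular ν r f ≤ C * varModular ν r g := by
  unfold varModular
  rw [← lintegral_const_mul' _ _ hC]
  exact lintegral_mono h

lemma ofReal_abs_mul_rpow {c t a : ℝ} (hc : 0 ≤ c) (ha : 0 ≤ a) :
    ENNReal.ofReal |c * t| ^ a = ENNReal.ofReal c ^ a * ENNReal.ofReal |t| ^ a := by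
  rw [abs_mul, abs_of_nonneg hc, ENNReal.ofReal_mul hc, ENNReal.mul_rpow_of_nonneg _ _ ha]

lemma varModular_mul_le_of_le_one (hr : ∀ z, 1 ≤ r z) {c : ℝ} (hc0 : 0 ≤ c) (hc1 : c ≤ 1)
    (f : Z → ℝ) :
    varModular ν r (fun z => c * f z) ≤ ENNReal.ofReal c * varModular ν r f := by
  refine varModular_le_of_pointwise ENNReal.ofReal_ne_top fun z => ?_
  rw [ofReal_abs_mul_rpow hc0 (zero_le_one.trans (hr z))]
  gcongr
  calc ENNReal.ofReal c ^ r z ≤ ENNReal.ofReal c ^ (1 : ℝ) :=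
        ENNReal.rpow_le_rpow_of_exponent_ge (ENNReal.ofReal_le_one.2 hc1) (hr z)
    _ = _ := ENNReal.rpow_one _

lemma varModular_mul_le {P : ℝ} (hr : ∀ z, 0 ≤ r z ∧ r z ≤ P) {c : ℝ} (hc : 1 ≤ c)
    (f : Z → ℝ) :
    varModular ν r (fun z => c * f z) ≤ ENNReal.ofReal (c ^ P) * varModular ν r f := by
  refine varModular_le_of_pointwise ENNReal.ofReal_ne_top fun z => ?_
  rw [ofReal_abs_mul_rpow (zero_le_one.trans hc) (hr z).1]
  gcongr
  rw [← ENNReal.ofReal_rpow_of_pos (by linarith)]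
  exact ENNReal.rpow_le_rpow_of_exponent_le (ENNReal.one_le_ofReal.2 hc) (hr z).2

lemma exists_varModular_clarkson {q P κ : ℝ} (hq : 1 < q) (hκ : 0 < κ) (hrm : Measurable r)
    (hr : ∀ z, r z ∈ Icc q P) :
    ∃ δ : ℝ, 0 < δ ∧ ∀ f g : Z → ℝ, Measurable f → Measurable g →
      varModular ν r (fun z => (f z + g z) / 2) +
          ENNReal.ofReal δ * varModular ν r (fun z => (f z - g z) / 2) ≤
        ENNReal.ofReal ((1 + κ * δ) / 2) * (varModular ν r f + varModular ν r g) := by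
  obtain ⟨δ, hδ, h⟩ := exists_rpow_clarkson (P := P) hq hκ
  refine ⟨δ, hδ, fun f g hf hg => ?_⟩
  unfold varModular
  rw [← lintegral_const_mul' _ _ ENNReal.ofReal_ne_top, ← lintegral_add_left (by fun_prop),
    ← lintegral_add_left (by fun_prop), ← lintegral_const_mul' _ _ ENNReal.ofReal_ne_top]
  refine lintegral_mono fun z => ?_
  have hr0 : 0 ≤ r z := by linarith [(hr z).1]
  have := h (r z) (hr z) (f z) (g z)
  simp only [ENNReal.ofReal_rpow_of_nonneg (abs_nonneg _) hr0]
  rw [← ENNReal.ofReal_mul hδ.le, ← ENNReal.ofReal_add (by positivity) (by positivity),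
    ← ENNReal.ofReal_add (by positivity) (by positivity), ← ENNReal.ofReal_mul (by positivity)]
  refine ENNReal.ofReal_le_ofReal (this.trans_eq (by ring))

lemma varModular_midpoint_lt_top {q P : ℝ} (hq : 1 < q) (hrm : Measurable r)
    (hr : ∀ z, r z ∈ Icc q P) {f g : Z → ℝ} (hf : Measurable f) (hg : Measurable g)
    (hf' : varModular ν r f < ⊤) (hg' : varModular ν r g < ⊤) :
    varModular ν r (fun z => (f z + g z) / 2) < ⊤ := by
  obtain ⟨δ, -, h⟩ := exists_varModular_clarkson (ν := ν) hq one_pos hrm hr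
  exact lt_of_le_of_lt (le_self_add.trans (h f g hf hg))
    (ENNReal.mul_lt_top ENNReal.ofReal_lt_top (ENNReal.add_lt_top.2 ⟨hf', hg'⟩))

/-- Uniform convexity of the modular. -/
lemma exists_varModular_midpoint_le {q P c : ℝ} (hq : 1 < q) (hc : 0 < c) (hrm : Measurable r)
    (hr : ∀ z, r z ∈ Icc q P) :
    ∃ τ : ℝ, 0 < τ ∧ ∀ f g : Z → ℝ, Measurable f → Measurable g →
      varModular ν r f ≤ 1 → varModular ν r g ≤ 1 →
      ENNReal.ofReal c ≤ varModular ν r (fun z => (f z - g z) / 2) →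
      varModular ν r (fun z => (f z + g z) / 2) ≤ ENNReal.ofReal (1 - τ) := by
  obtain ⟨δ, hδ, h⟩ := exists_varModular_clarkson (ν := ν) hq (half_pos hc) hrm hr
  refine ⟨δ * c / 2, by positivity, fun f g hf hg hf1 hg1 hfg => ?_⟩
  have hfin := varModular_midpoint_lt_top (ν := ν) hq hrm hr hf hg
    (hf1.trans_lt ENNReal.one_lt_top) (hg1.trans_lt ENNReal.one_lt_top)
  have key : varModular ν r (fun z => (f z + g z) / 2) + ENNReal.ofReal (δ * c) ≤
      ENNReal.ofReal (1 + δ * c / 2) :=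
    calc _ ≤ varModular ν r (fun z => (f z + g z) / 2) +
          ENNReal.ofReal δ * varModular ν r (fun z => (f z - g z) / 2) := by
          rw [ENNReal.ofReal_mul hδ.le]; gcongr
      _ ≤ ENNReal.ofReal ((1 + c / 2 * δ) / 2) * (varModular ν r f + varModular ν r g) :=
          h f g hf hg
      _ ≤ ENNReal.ofReal ((1 + c / 2 * δ) / 2) * (1 + 1) := by gcongr
      _ = ENNReal.ofReal (1 + δ * c / 2) := by
          rw [one_add_one_eq_two, ← ENNReal.ofReal_ofNat 2, ← ENNReal.ofReal_mul (by positivity)]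
          ring_nf
  rw [← ENNReal.ofReal_toReal hfin.ne, ← ENNReal.ofReal_add ENNReal.toReal_nonneg (by positivity),
    ENNReal.ofReal_le_ofReal_iff (by positivity)] at key
  exact (ENNReal.le_ofReal_iff_toReal_le hfin.ne
    (by linarith [ENNReal.toReal_nonneg (a := varModular ν r (fun z => (f z + g z) / 2))])).2
    (by linarith)

lemma varLux_nonneg (f : Z → ℝ) : 0 ≤ varLux ν r f :=
  Real.sInf_nonneg fun _ hl => hl.1.le

lemma varLux_le {f : Z → ℝ} {l : ℝ} (hl : 0 < l)
    (h : varModular ν r (fun z => f z / l) < 1) : varLux ν r f ≤ l :=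
  csInf_le ⟨0, fun _ ht => ht.1.le⟩ ⟨hl, h⟩

lemma one_le_varModular_of_lt_varLux {f : Z → ℝ} {l : ℝ} (hl : 0 < l) (h : l < varLux ν r f) :
    1 ≤ varModular ν r (fun z => f z / l) := by
  by_contra! hlt
  exact absurd (varLux_le hl hlt) (not_le.2 h)

lemma varModular_div_le (hr : ∀ z, 1 ≤ r z) {f : Z → ℝ} {l m : ℝ} (hl : 0 < l) (hlm : l ≤ m) :
    varModular ν r (fun z => f z / m) ≤
      ENNReal.ofReal (l / m) * varModular ν r (fun z => f z / l) := by
  have hm : 0 < m := hl.trans_le hlm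
  refine le_of_eq_of_le ?_ (varModular_mul_le_of_le_one hr (c := l / m) (by positivity)
    (div_le_one_of_le₀ hlm hm.le) _)
  congr 1
  ext z
  field_simp

lemma varModular_div_anti (hr : ∀ z, 1 ≤ r z) {f : Z → ℝ} {l m : ℝ} (hl : 0 < l)
    (hlm : l ≤ m) :
    varModular ν r (fun z => f z / m) ≤ varModular ν r (fun z => f z / l) :=
  (varModular_div_le hr hl hlm).trans <| mul_le_of_le_one_left' <|
    ENNReal.ofReal_le_one.2 (div_le_one_of_le₀ hlm (hl.trans_le hlm).le)

lemma exists_varModular_div_lt_one (hr : ∀ z, 1 ≤ r z) {f : Z → ℝ}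
    (h : ∃ l, 0 < l ∧ varModular ν r (fun z => f z / l) < ⊤) :
    ∃ l, 0 < l ∧ varModular ν r (fun z => f z / l) < 1 := by
  obtain ⟨l, hl, hfin⟩ := h
  set A := (varModular ν r (fun z => f z / l)).toReal with hA
  have hA0 : 0 ≤ A := ENNReal.toReal_nonneg
  refine ⟨l * (A + 1), by positivity, ?_⟩
  refine (varModular_div_le hr hl (le_mul_of_one_le_right hl.le (by linarith))).trans_lt ?_
  rw [← ENNReal.ofReal_toReal hfin.ne, ← hA, ← ENNReal.ofReal_mul (by positivity),
    ENNReal.ofReal_lt_one]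
  field_simp
  linarith

lemma varModular_lt_one_of_varLux_lt (hr : ∀ z, 1 ≤ r z) {f : Z → ℝ}
    (h : ∃ l, 0 < l ∧ varModular ν r (fun z => f z / l) < ⊤) {m : ℝ} (hm : varLux ν r f < m) :
    varModular ν r (fun z => f z / m) < 1 := by
  obtain ⟨l, ⟨hl, h1⟩, hlm⟩ := exists_lt_of_csInf_lt (exists_varModular_div_lt_one hr h) hm
  exact (varModular_div_anti hr hl hlm.le).trans_lt h1

lemma varModular_le_one_of_varLux_le_one {P : ℝ} (hr : ∀ z, 1 ≤ r z ∧ r z ≤ P) {f : Z → ℝ}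
    (h : ∃ l, 0 < l ∧ varModular ν r (fun z => f z / l) < ⊤) (h1 : varLux ν r f ≤ 1) :
    varModular ν r f ≤ 1 := by
  have hle : ∀ c : ℝ, 1 < c → varModular ν r f ≤ ENNReal.ofReal (c ^ P) := by
    intro c hc
    have hc0 : 0 < c := one_pos.trans hc
    calc varModular ν r f = varModular ν r (fun z => c * (f z / c)) := by
          congr 1; ext z; field_simp
      _ ≤ ENNReal.ofReal (c ^ P) * varModular ν r (fun z => f z / c) :=
          varModular_mul_le (fun z => ⟨zero_le_one.trans (hr z).1, (hr z).2⟩) hc.le _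
      _ ≤ ENNReal.ofReal (c ^ P) * 1 := by
          gcongr
          exact (varModular_lt_one_of_varLux_lt (fun z => (hr z).1) h (h1.trans_lt hc)).le
      _ = _ := mul_one _
  have hlim : Tendsto (fun c : ℝ => ENNReal.ofReal (c ^ P)) (nhdsWithin 1 (Ioi 1))
      (nhds (ENNReal.ofReal ((1 : ℝ) ^ P))) :=
    (ENNReal.continuous_ofReal.continuousAt.comp
      (Real.continuousAt_rpow_const 1 P (Or.inl one_ne_zero))).tendsto.mono_left
      nhdsWithin_le_nhds
  rw [Real.one_rpow, ENNReal.ofReal_one] at hlim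
  exact ge_of_tendsto hlim (eventually_nhdsWithin_of_forall hle)

/-- Uniform convexity of the Luxemburg functional. -/
lemma exists_varLux_midpoint_le {q P ε : ℝ} (hq : 1 < q) (hε : 0 < ε) (hrm : Measurable r)
    (hr : ∀ z, r z ∈ Icc q P) :
    ∃ δ : ℝ, 0 < δ ∧ ∀ f g : Z → ℝ, Measurable f → Measurable g →
      (∃ l, 0 < l ∧ varModular ν r (fun z => f z / l) < ⊤) →
      (∃ l, 0 < l ∧ varModular ν r (fun z => g z / l) < ⊤) →
      varLux ν r f ≤ 1 → varLux ν r g ≤ 1 → ε ≤ varLux ν r (fun z => f z - g z) →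
      varLux ν r (fun z => (f z + g z) / 2) ≤ 1 - δ := by
  have hr1 : ∀ z, 1 ≤ r z ∧ r z ≤ P := fun z => ⟨hq.le.trans (hr z).1, (hr z).2⟩
  have hr0 : ∀ z, 0 ≤ r z ∧ r z ≤ P := fun z => ⟨zero_le_one.trans (hr1 z).1, (hr z).2⟩
  set M : ℝ := max (4 / ε) 1 with hM
  have hM1 : 1 ≤ M := le_max_right _ _
  have hMP : 0 < M ^ P := Real.rpow_pos_of_pos (by linarith) P
  obtain ⟨τ, hτ, h⟩ := exists_varModular_midpoint_le (ν := ν) hq (inv_pos.2 hMP) hrm hr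
  obtain ⟨l, ⟨hl0, hl1⟩, hlP⟩ : ∃ l : ℝ, l ∈ Ioo (0 : ℝ) 1 ∧ 1 - τ < l ^ P := by
    have hlim : Tendsto (fun l : ℝ => l ^ P) (nhdsWithin 1 (Iio 1)) (nhds ((1 : ℝ) ^ P)) :=
      (Real.continuousAt_rpow_const 1 P (Or.inl one_ne_zero)).tendsto.mono_left
        nhdsWithin_le_nhds
    rw [Real.one_rpow] at hlim
    have hev := hlim.eventually (lt_mem_nhds (show 1 - τ < 1 by linarith))
    obtain ⟨l, hl, hl'⟩ := (hev.and (Ioo_mem_nhdsLT (zero_lt_one' ℝ))).exists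
    exact ⟨l, hl', hl⟩
  refine ⟨1 - l, by linarith, fun f g hf hg hff hgf hf1 hg1 hfg => ?_⟩
  have hdiff : ENNReal.ofReal (M ^ P)⁻¹ ≤ varModular ν r (fun z => (f z - g z) / 2) := by
    have h1 := one_le_varModular_of_lt_varLux (half_pos hε)
      ((half_lt_self hε).trans_le hfg)
    have hanti : varModular ν r (fun z => (f z - g z) / (ε / 2)) ≤
        varModular ν r (fun z => M * ((f z - g z) / 2)) := by
      refine lintegral_mono fun z => ?_
      refine ENNReal.rpow_le_rpow (ENNReal.ofReal_le_ofReal ?_) (hr0 z).1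
      dsimp only
      have e : (f z - g z) / (ε / 2) = 4 / ε * ((f z - g z) / 2) := by field_simp; norm_num
      rw [e, abs_mul, abs_mul, abs_of_pos (by positivity : 0 < 4 / ε), abs_of_pos
        (by linarith : 0 < M)]
      gcongr
      exact le_max_left _ _
    have h2 := (h1.trans hanti).trans (varModular_mul_le hr0 hM1 _)
    rw [ENNReal.ofReal_inv_of_pos hMP]
    rw [← one_div]
    exact ENNReal.div_le_of_le_mul' h2
  have hmid := h f g hf hg (varModular_le_one_of_varLux_le_one hr1 hff hf1)
    (varModular_le_one_of_varLux_le_one hr1 hgf hg1) hdiff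
  rw [_root_.sub_sub_cancel]
  refine varLux_le hl0 ?_
  have hlP0 : 0 < l ^ P := Real.rpow_pos_of_pos hl0 P
  calc varModular ν r (fun z => (f z + g z) / 2 / l)
      = varModular ν r (fun z => l⁻¹ * ((f z + g z) / 2)) := by
        congr 1; ext z; field_simp
    _ ≤ ENNReal.ofReal (l⁻¹ ^ P) * ENNReal.ofReal (1 - τ) := by
        refine (varModular_mul_le hr0 (one_le_inv₀ hl0 |>.2 hl1.le) _).trans ?_
        gcongr
    _ < 1 := by
        rw [← ENNReal.ofReal_mul (by positivity), ENNReal.ofReal_lt_one, Real.inv_rpow hl0.le,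
          inv_mul_lt_iff₀ hlP0]
        linarith

lemma exists_varModular_div_sub_lt_top {q P : ℝ} (hq : 1 < q) (hrm : Measurable r)
    (hr : ∀ z, r z ∈ Icc q P) {f g : Z → ℝ} (hf : Measurable f) (hg : Measurable g)
    (hff : ∃ l, 0 < l ∧ varModular ν r (fun z => f z / l) < ⊤)
    (hgf : ∃ l, 0 < l ∧ varModular ν r (fun z => g z / l) < ⊤) :
    ∃ l, 0 < l ∧ varModular ν r (fun z => (f z - g z) / l) < ⊤ := by
  have hr1 : ∀ z, 1 ≤ r z := fun z => hq.le.trans (hr z).1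
  obtain ⟨l, hl, hfl⟩ := hff
  obtain ⟨m, hm, hgm⟩ := hgf
  have hlm : 0 < max l m := lt_max_of_lt_left hl
  refine ⟨2 * max l m, by positivity, ?_⟩
  have hf' := (varModular_div_anti hr1 hl (le_max_left l m)).trans_lt hfl
  have hg' : varModular ν r (fun z => -(g z / max l m)) < ⊤ := by
    unfold varModular
    simp only [abs_neg]
    exact (varModular_div_anti hr1 hm (le_max_right l m)).trans_lt hgm
  have := varModular_midpoint_lt_top hq hrm hr (hf.div_const _) (hg.div_const _).neg hf' hg'
  convert this using 3 with z
  simp only [Pi.neg_apply]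
  field_simp
  ring

/-- Fatou's lemma for the modular. -/
lemma varModular_le_of_tendsto (hrm : Measurable r) {F : ℕ → Z → ℝ}
    {f : Z → ℝ} (hF : ∀ k, Measurable (F k))
    (hlim : ∀ᵐ z ∂ν, Tendsto (fun k => F k z) atTop (nhds (f z))) {C : ℝ≥0∞}
    (hC : ∀ᶠ k in atTop, varModular ν r (F k) ≤ C) : varModular ν r f ≤ C := by
  calc varModular ν r f
      = ∫⁻ z, liminf (fun k => ENNReal.ofReal |F k z| ^ r z) atTop ∂ν := by
        refine lintegral_congr_ae ?_
        filter_upwards [hlim] with z hz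
        refine (Tendsto.liminf_eq ?_).symm
        exact ((ENNReal.continuous_rpow_const.comp ENNReal.continuous_ofReal).comp
          continuous_abs).continuousAt.tendsto.comp hz
    _ ≤ liminf (fun k => varModular ν r (F k)) atTop := by
        refine lintegral_liminf_le fun k => Measurable.pow ?_ hrm
        exact ENNReal.measurable_ofReal.comp (hF k).norm
    _ ≤ liminf (fun _ : ℕ => C) atTop := liminf_le_liminf hC
    _ = C := liminf_const C

end VarModular

lemma inf2_le {f : RN N → RN N → ℝ} (h : 0 < inf2 f) (x y : RN N) : inf2 f ≤ f x y := by
  refine csInf_le ?_ ⟨x, y, rfl⟩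
  by_contra hb
  exact h.ne' (Real.sInf_of_not_bddBelow hb)

lemma le_sup2 {f : RN N → RN N → ℝ} (h : BddAbove {t | ∃ x y, f x y = t}) (x y : RN N) :
    f x y ≤ sup2 f :=
  le_csSup h ⟨x, y, rfl⟩

section Gagliardo

variable {s p : RN N → RN N → ℝ}

/-- The measure `dx dy / |x - y| ^ (N + s p)`. -/
def gagliardoMeasure (s p : RN N → RN N → ℝ) : Measure (RN N × RN N) :=
  volume.withDensity fun z =>
    (ENNReal.ofReal (dist z.1 z.2) ^ ((N : ℝ) + s z.1 z.2 * p z.1 z.2))⁻¹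

lemma measurable_kernel (hs : Measurable fun z : RN N × RN N => s z.1 z.2)
    (hp : Measurable fun z : RN N × RN N => p z.1 z.2) :
    Measurable fun z : RN N × RN N =>
      ENNReal.ofReal (dist z.1 z.2) ^ ((N : ℝ) + s z.1 z.2 * p z.1 z.2) :=
  (ENNReal.measurable_ofReal.comp measurable_dist).pow (measurable_const.add (hs.mul hp))

lemma measurable_gagliardo (hs : Measurable fun z : RN N × RN N => s z.1 z.2)
    (hp : Measurable fun z : RN N × RN N => p z.1 z.2) {u : RN N → ℝ} (hu : Measurable u)
    (l : ℝ) :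
    Measurable fun z : RN N × RN N =>
      ENNReal.ofReal (|u z.1 - u z.2| / l) ^ p z.1 z.2 /
        ENNReal.ofReal (dist z.1 z.2) ^ ((N : ℝ) + s z.1 z.2 * p z.1 z.2) := by
  refine Measurable.div (Measurable.pow ?_ hp) (measurable_kernel hs hp)
  fun_prop

lemma gmodular_univ_eq (hs : Measurable fun z : RN N × RN N => s z.1 z.2)
    (hp : Measurable fun z : RN N × RN N => p z.1 z.2) {u : RN N → ℝ} (hu : Measurable u)
    {l : ℝ} (hl : 0 < l) :
    gmodular univ s p u l = varModular (gagliardoMeasure s p) (fun z => p z.1 z.2)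
      (fun z => (u z.1 - u z.2) / l) := by
  have hm : Measurable fun z : RN N × RN N =>
      ENNReal.ofReal |(u z.1 - u z.2) / l| ^ p z.1 z.2 := by
    refine Measurable.pow ?_ hp
    fun_prop
  unfold gmodular varModular gagliardoMeasure
  rw [Measure.restrict_univ]
  refine Eq.trans ?_
    (lintegral_withDensity_eq_lintegral_mul _ (measurable_kernel hs hp).inv hm).symm
  refine lintegral_congr fun z => ?_
  rw [Pi.mul_apply, abs_div, abs_of_pos hl, div_eq_mul_inv, mul_comm]
  rfl

lemma x0Norm_eq (hs : Measurable fun z : RN N × RN N => s z.1 z.2)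
    (hp : Measurable fun z : RN N × RN N => p z.1 z.2) {u : RN N → ℝ} (hu : Measurable u) :
    x0Norm s p u =
      varLux (gagliardoMeasure s p) (fun z => p z.1 z.2) (fun z => u z.1 - u z.2) := by
  unfold x0Norm varLux
  congr 1
  ext l
  refine and_congr_right fun hl => ?_
  rw [gmodular_univ_eq hs hp hu hl]

lemma gmodular_univ_le_Qset (hp : ∀ x y, 0 < p x y) {Ω : Set (RN N)} (hΩ : MeasurableSet Ω)
    {u : RN N → ℝ} (hu : ∀ᵐ x, x ∉ Ω → u x = 0) (l : ℝ) :
    gmodular univ s p u l ≤ gmodular (Qset Ω) s p u l := by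
  have hQ : MeasurableSet (Qset Ω) := MeasurableSet.univ.diff (hΩ.compl.prod hΩ.compl)
  unfold gmodular
  rw [Measure.restrict_univ, ← lintegral_indicator hQ]
  refine lintegral_mono_ae ?_
  have h1 : ∀ᵐ z : RN N × RN N, z.1 ∉ Ω → u z.1 = 0 :=
    Measure.quasiMeasurePreserving_fst.ae hu
  have h2 : ∀ᵐ z : RN N × RN N, z.2 ∉ Ω → u z.2 = 0 :=
    Measure.quasiMeasurePreserving_snd.ae hu
  filter_upwards [h1, h2] with z h1 h2
  by_cases hz : z ∈ Qset Ω
  · rw [indicator_of_mem hz]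
  · have hz' : z.1 ∉ Ω ∧ z.2 ∉ Ω := by simpa [Qset] using hz
    rw [h1 hz'.1, h2 hz'.2]
    simp [ENNReal.zero_rpow_of_pos (hp z.1 z.2)]

/-- A Poincaré type inequality for functions vanishing outside a bounded set. -/
lemma exists_lintegral_le_gmodular (hN : 0 < N) {P : ℝ}
    (hs : ∀ x y, 0 ≤ s x y ∧ s x y ≤ 1) (hp : ∀ x y, 1 ≤ p x y ∧ p x y ≤ P)
    {Ω : Set (RN N)} (hΩ : MeasurableSet Ω) (hΩb : Bornology.IsBounded Ω) :
    ∃ C : ℝ≥0∞, C ≠ ⊤ ∧ ∀ w : RN N → ℝ, Measurable w → (∀ᵐ x, x ∉ Ω → w x = 0) →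
      ∀ l : ℝ, 0 < l → gmodular univ s p w l ≤ 1 →
        ∫⁻ x, ENNReal.ofReal |w x| ≤ ENNReal.ofReal l * C := by
  have : Nonempty (Fin N) := ⟨⟨0, hN⟩⟩
  obtain ⟨R, hR0, hR⟩ := hΩb.subset_ball_lt 0 (0 : RN N)
  obtain ⟨y₀, hy₀⟩ := NormedSpace.exists_lt_norm ℝ (RN N) (R + 1)
  set Y := Metric.ball y₀ 1 with hY
  set D : ℝ := R + ‖y₀‖ + 1 with hD
  have hD1 : 1 ≤ D := by linarith [norm_nonneg y₀]
  set K : ℝ≥0∞ := ENNReal.ofReal D ^ ((N : ℝ) + P) with hK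
  have hKtop : K ≠ ⊤ := by
    rw [hK, ENNReal.ofReal_rpow_of_pos (by linarith)]
    exact ENNReal.ofReal_ne_top
  have hYpos : volume Y ≠ 0 := (Metric.measure_ball_pos volume y₀ one_pos).ne'
  have hYtop : volume Y ≠ ⊤ := measure_ball_lt_top.ne
  have hΩtop : volume Ω ≠ ⊤ := hΩb.measure_lt_top.ne
  refine ⟨(volume Ω * volume Y + K) / volume Y, ENNReal.div_ne_top
    (ENNReal.add_ne_top.2 ⟨ENNReal.mul_ne_top hΩtop hYtop, hKtop⟩) hYpos, ?_⟩
  intro w hw hw0 l hl hg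
  have hae : ∀ᵐ z : RN N × RN N, z.2 ∉ Ω → w z.2 = 0 :=
    Measure.quasiMeasurePreserving_snd.ae hw0
  have hpt : ∀ᵐ z : RN N × RN N, z ∈ Ω ×ˢ Y → ENNReal.ofReal (|w z.1| / l) ≤
      1 + K * (ENNReal.ofReal (|w z.1 - w z.2| / l) ^ p z.1 z.2 /
        ENNReal.ofReal (dist z.1 z.2) ^ ((N : ℝ) + s z.1 z.2 * p z.1 z.2)) := by
    filter_upwards [hae] with z hz hmem
    have hz1 : ‖z.1‖ < R := by simpa using hR hmem.1
    have hz2 : dist z.2 y₀ < 1 := hmem.2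
    rw [dist_eq_norm] at hz2
    have hz2' : R < ‖z.2‖ := by
      have := norm_sub_norm_le y₀ z.2
      rw [norm_sub_rev] at this
      linarith
    have hz2'' : ‖z.2‖ < ‖y₀‖ + 1 := by
      have := norm_sub_norm_le z.2 y₀
      linarith
    have hnot : z.2 ∉ Ω := fun hcon => by
      have : ‖z.2‖ < R := by simpa using hR hcon
      linarith
    have hdpos : 0 < dist z.1 z.2 := dist_pos.2 fun he => by
      rw [he] at hz1
      linarith
    have hdle : dist z.1 z.2 ≤ D := by
      rw [dist_eq_norm]
      linarith [norm_sub_le z.1 z.2]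
    rw [hz hnot, sub_zero]
    set t := ENNReal.ofReal (|w z.1| / l) with ht
    set κ := ENNReal.ofReal (dist z.1 z.2) ^ ((N : ℝ) + s z.1 z.2 * p z.1 z.2) with hκ
    have hκe : 0 ≤ (N : ℝ) + s z.1 z.2 * p z.1 z.2 := by
      have := mul_nonneg (hs z.1 z.2).1 (zero_le_one.trans (hp z.1 z.2).1)
      positivity
    have hκeP : (N : ℝ) + s z.1 z.2 * p z.1 z.2 ≤ N + P := by
      have := hs z.1 z.2
      have := hp z.1 z.2
      nlinarith
    have hκK : κ ≤ K :=
      (ENNReal.rpow_le_rpow (ENNReal.ofReal_le_ofReal hdle) hκe).trans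
        (ENNReal.rpow_le_rpow_of_exponent_le (ENNReal.one_le_ofReal.2 hD1) hκeP)
    have hκ0 : κ ≠ 0 := (ENNReal.rpow_pos (ENNReal.ofReal_pos.2 hdpos) ENNReal.ofReal_ne_top).ne'
    have h1 : t ≤ 1 + t ^ p z.1 z.2 := by
      rcases le_total t 1 with h | h
      · exact h.trans le_self_add
      · refine le_trans ?_ le_add_self
        calc t = t ^ (1 : ℝ) := (ENNReal.rpow_one t).symm
          _ ≤ _ := ENNReal.rpow_le_rpow_of_exponent_le h (hp z.1 z.2).1
    refine h1.trans (add_le_add le_rfl ?_)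
    calc t ^ p z.1 z.2 = κ * (t ^ p z.1 z.2 / κ) :=
          (ENNReal.mul_div_cancel hκ0 (ne_top_of_le_ne_top hKtop hκK)).symm
      _ ≤ _ := by gcongr
  have hint : (∫⁻ x in Ω, ENNReal.ofReal (|w x| / l)) * volume Y ≤
      volume Ω * volume Y + K := by
    have hmw : Measurable fun x => ENNReal.ofReal (|w x| / l) := by fun_prop
    calc (∫⁻ x in Ω, ENNReal.ofReal (|w x| / l)) * volume Y
        = ∫⁻ z in Ω ×ˢ Y, ENNReal.ofReal (|w z.1| / l) := by
          rw [Measure.volume_eq_prod, setLIntegral_prod _ (by fun_prop)]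
          simp only [lintegral_const, Measure.restrict_apply_univ]
          rw [lintegral_mul_const _ hmw]
      _ ≤ ∫⁻ z in Ω ×ˢ Y, (1 + K * (ENNReal.ofReal (|w z.1 - w z.2| / l) ^ p z.1 z.2 /
            ENNReal.ofReal (dist z.1 z.2) ^ ((N : ℝ) + s z.1 z.2 * p z.1 z.2))) :=
          setLIntegral_mono_ae' (hΩ.prod Metric.isOpen_ball.measurableSet) hpt
      _ ≤ volume Ω * volume Y + K * gmodular univ s p w l := by
          rw [lintegral_add_left measurable_const, lintegral_const_mul' _ _ hKtop,
            setLIntegral_one, Measure.volume_eq_prod, Measure.prod_prod]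
          gcongr
          exact lintegral_mono_set (subset_univ _)
      _ ≤ volume Ω * volume Y + K * 1 := by gcongr
      _ = _ := by rw [mul_one]
  calc ∫⁻ x, ENNReal.ofReal |w x| = ∫⁻ x in Ω, ENNReal.ofReal |w x| := by
        rw [← lintegral_indicator hΩ]
        refine lintegral_congr_ae ?_
        filter_upwards [hw0] with x hx
        by_cases hxΩ : x ∈ Ω
        · rw [indicator_of_mem hxΩ]
        · rw [indicator_of_notMem hxΩ, hx hxΩ]
          simp
    _ = ENNReal.ofReal l * ∫⁻ x in Ω, ENNReal.ofReal (|w x| / l) := by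
        rw [← lintegral_const_mul' _ _ ENNReal.ofReal_ne_top]
        refine lintegral_congr fun x => ?_
        rw [← ENNReal.ofReal_mul hl.le]
        congr 1
        field_simp
    _ ≤ _ := by
        gcongr
        rwa [ENNReal.le_div_iff_mul_le (Or.inl hYpos) (Or.inl hYtop)]

lemma exists_ball_subset_ball_inter {z x : RN N} {ρ r : ℝ} (hr : 0 < r) (hrρ : r ≤ ρ)
    (hx : x ∈ Metric.ball z ρ) :
    ∃ c, Metric.ball c r ⊆ Metric.ball z ρ ∩ Metric.ball x (2 * r) := by
  have hρ : 0 < ρ := hr.trans_le hrρ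
  have hxz : dist x z < ρ := hx
  refine ⟨AffineMap.lineMap x z (r / ρ), fun y hy => ?_⟩
  have hy' : dist y (AffineMap.lineMap x z (r / ρ)) < r := hy
  have h1 : dist (AffineMap.lineMap x z (r / ρ)) x = r / ρ * dist x z := by
    rw [dist_lineMap_left, Real.norm_of_nonneg (by positivity)]
  have h2 : dist (AffineMap.lineMap x z (r / ρ)) z = (1 - r / ρ) * dist x z := by
    rw [dist_lineMap_right, Real.norm_of_nonneg (by
      have := div_le_one_of_le₀ hrρ hρ.le
      linarith)]
  have h3 : r / ρ * dist x z ≤ r := by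
    calc r / ρ * dist x z ≤ r / ρ * ρ := by gcongr
      _ = r := by field_simp
  have h4 : (1 - r / ρ) * dist x z ≤ ρ - r := by
    have : 0 ≤ 1 - r / ρ := by
      have := div_le_one_of_le₀ hrρ hρ.le
      linarith
    calc (1 - r / ρ) * dist x z ≤ (1 - r / ρ) * ρ := by gcongr
      _ = ρ - r := by field_simp
  constructor
  · have := dist_triangle y (AffineMap.lineMap x z (r / ρ)) z
    rw [Metric.mem_ball]
    linarith
  · have := dist_triangle y (AffineMap.lineMap x z (r / ρ)) x
    rw [Metric.mem_ball]
    linarith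

/-- One step of the level set iteration behind the local fractional Sobolev inequality. -/
lemma volume_superlevel_mul_le (hsm : Measurable fun z : RN N × RN N => s z.1 z.2)
    (hpm : Measurable fun z : RN N × RN N => p z.1 z.2) {w : RN N → ℝ} (hw : Measurable w)
    {z : RN N} {ρ r L p₀ τ : ℝ} (hρ : ρ ≤ 1 / 2) (hr : 0 < r) (hrρ : r ≤ ρ) (hL : 1 ≤ L)
    (hp₀ : 0 ≤ p₀) (hτ : 0 ≤ τ)
    (hp : ∀ x ∈ Metric.ball z ρ, ∀ y ∈ Metric.ball z ρ, p₀ ≤ p x y ∧ τ ≤ s x y * p x y)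
    (hA : volume {x ∈ Metric.ball z ρ | L < |w x|} ≤ volume (Metric.ball (0 : RN N) r) / 2) :
    volume {x ∈ Metric.ball z ρ | 2 * L < |w x|} *
      (ENNReal.ofReal L ^ p₀ / ENNReal.ofReal (2 * r) ^ ((N : ℝ) + τ) *
        (volume (Metric.ball (0 : RN N) r) / 2)) ≤ gmodular univ s p w 1 := by
  set B := Metric.ball z ρ with hB
  set A := {x ∈ B | L < |w x|} with hAdef
  set A' := {x ∈ B | 2 * L < |w x|} with hA'def
  have hBm : MeasurableSet B := Metric.isOpen_ball.measurableSet
  have hAm : MeasurableSet A := hBm.inter (measurableSet_lt measurable_const hw.norm)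
  have hA'm : MeasurableSet A' := hBm.inter (measurableSet_lt measurable_const hw.norm)
  set κ := ENNReal.ofReal L ^ p₀ / ENNReal.ofReal (2 * r) ^ ((N : ℝ) + τ) with hκ
  set F : RN N × RN N → ℝ≥0∞ := fun z =>
    ENNReal.ofReal (|w z.1 - w z.2| / 1) ^ p z.1 z.2 /
        ENNReal.ofReal (dist z.1 z.2) ^ ((N : ℝ) + s z.1 z.2 * p z.1 z.2) with hF
  have hFm : Measurable F := measurable_gagliardo hsm hpm hw 1
  have hinner : ∀ x ∈ A', κ * (volume (Metric.ball (0 : RN N) r) / 2) ≤ ∫⁻ y, F (x, y) := by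
    intro x hx
    obtain ⟨c, hc⟩ := exists_ball_subset_ball_inter hr hrρ hx.1
    have hTm : MeasurableSet (Metric.ball c r \ A) := Metric.isOpen_ball.measurableSet.diff hAm
    have hvol : volume (Metric.ball (0 : RN N) r) / 2 ≤ volume (Metric.ball c r \ A) := by
      refine le_trans ?_ le_measure_sdiff
      rw [Measure.addHaar_ball_center volume c]
      refine le_trans ?_ (tsub_le_tsub_left hA _)
      rw [ENNReal.sub_half measure_ball_lt_top.ne]
    calc κ * (volume (Metric.ball (0 : RN N) r) / 2) ≤ κ * volume (Metric.ball c r \ A) := by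
          gcongr
      _ = ∫⁻ y in Metric.ball c r \ A, κ := (setLIntegral_const _ _).symm
      _ ≤ ∫⁻ y in Metric.ball c r \ A, F (x, y) := by
          refine setLIntegral_mono' hTm fun y hy => ?_
          have hyB : y ∈ B := (hc hy.1).1
          have hyx : dist x y ≤ 2 * r := by
            rw [dist_comm]; exact (Metric.mem_ball.1 (hc hy.1).2).le
          have hwy : |w y| ≤ L := by
            by_contra! hcon
            exact hy.2 ⟨hyB, hcon⟩
          have hwx : 2 * L < |w x| := hx.2
          have hdiff : L ≤ |w x - w y| / 1 := by
            rw [div_one]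
            linarith [abs_sub_abs_le_abs_sub (w x) (w y)]
          have hd1 : dist x y ≤ 1 := by
            have h1 : dist x z < ρ := hx.1
            have h2 : dist y z < ρ := hyB
            have := dist_triangle_right x y z
            linarith
          obtain ⟨hpxy, hτxy⟩ := hp x hx.1 y hyB
          refine ENNReal.div_le_div ?_ ?_
          · exact (ENNReal.rpow_le_rpow_of_exponent_le (ENNReal.one_le_ofReal.2 hL) hpxy).trans
              (ENNReal.rpow_le_rpow (ENNReal.ofReal_le_ofReal hdiff) (hp₀.trans hpxy))
          · exact (ENNReal.rpow_le_rpow_of_exponent_ge (ENNReal.ofReal_le_one.2 hd1)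
              (by linarith)).trans
              (ENNReal.rpow_le_rpow (ENNReal.ofReal_le_ofReal hyx) (by positivity))
      _ ≤ ∫⁻ y, F (x, y) := setLIntegral_le_lintegral _ _
  calc _ = ∫⁻ x in A', κ * (volume (Metric.ball (0 : RN N) r) / 2) := by
        rw [setLIntegral_const, mul_comm]
    _ ≤ ∫⁻ x in A', ∫⁻ y, F (x, y) := setLIntegral_mono' hA'm hinner
    _ ≤ ∫⁻ x, ∫⁻ y, F (x, y) := setLIntegral_le_lintegral _ _
    _ = gmodular univ s p w 1 := by
        unfold gmodular
        rw [Measure.restrict_univ, Measure.volume_eq_prod, lintegral_prod _ hFm.aemeasurable]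

lemma exists_volume_superlevel_le (hsm : Measurable fun z : RN N × RN N => s z.1 z.2)
    (hpm : Measurable fun z : RN N × RN N => p z.1 z.2) {w : RN N → ℝ} (hw : Measurable w)
    {z : RN N} {ρ p₀ τ : ℝ} (hρ0 : 0 < ρ) (hρ : ρ ≤ 1 / 2) (hp₀ : 0 < p₀) (hτ : 0 ≤ τ)
    (hτN : τ < N)
    (hp : ∀ x ∈ Metric.ball z ρ, ∀ y ∈ Metric.ball z ρ, p₀ ≤ p x y ∧ τ ≤ s x y * p x y)
    (hE : gmodular univ s p w 1 < ⊤) :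
    ∃ T : ℝ, 1 ≤ T ∧ ∀ k : ℕ, volume {x ∈ Metric.ball z ρ | T * 2 ^ k < |w x|} ≤
      volume (Metric.ball (0 : RN N) (ρ * ((2 : ℝ) ^ (-(p₀ / (N - τ)))) ^ k)) / 2 := by
  have hNτ : 0 < (N : ℝ) - τ := sub_pos.2 hτN
  have hN : 0 < N := by exact_mod_cast (hτ.trans_lt hτN)
  have : Nonempty (Fin N) := ⟨⟨0, hN⟩⟩
  set g : ℝ := (2 : ℝ) ^ (-(p₀ / (N - τ))) with hg
  have hg0 : 0 < g := by positivity
  have hg1 : g ≤ 1 :=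
    Real.rpow_le_one_of_one_le_of_nonpos one_le_two (neg_nonpos.2 (by positivity))
  have hgp : (2 : ℝ) ^ p₀ = g ^ (-((N : ℝ) - τ)) := by
    rw [hg, ← Real.rpow_mul zero_le_two]
    congr 1
    field_simp
  set V : ℝ := (volume (Metric.ball (0 : RN N) 1)).toReal with hV
  have hVtop : volume (Metric.ball (0 : RN N) 1) ≠ ⊤ := measure_ball_lt_top.ne
  have hV0 : 0 < V := ENNReal.toReal_pos (Metric.measure_ball_pos volume _ one_pos).ne' hVtop
  have hball : ∀ r : ℝ, 0 < r →
      volume (Metric.ball (0 : RN N) r) / 2 = ENNReal.ofReal (r ^ N * V / 2) := by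
    intro r hr
    rw [Measure.addHaar_ball volume (0 : RN N) hr.le, finrank_euclideanSpace_fin,
      ENNReal.ofReal_div_of_pos two_pos, ENNReal.ofReal_mul (by positivity), hV,
      ENNReal.ofReal_toReal hVtop, ENNReal.ofReal_ofNat]
  set E : ℝ := (gmodular univ s p w 1).toReal with hEdef
  set C : ℝ := (ρ * g) ^ N * ρ ^ N * (V / 2) ^ 2 / (2 * ρ) ^ ((N : ℝ) + τ) with hC
  have hC0 : 0 < C := by positivity
  have hlev : Tendsto (fun n : ℕ => volume {x ∈ Metric.ball z ρ | (n : ℝ) < |w x|}) atTop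
      (nhds 0) := by
    have hm : ∀ n : ℕ, MeasurableSet {x ∈ Metric.ball z ρ | (n : ℝ) < |w x|} := fun n =>
      Metric.isOpen_ball.measurableSet.inter (measurableSet_lt measurable_const hw.norm)
    have h := tendsto_measure_iInter_atTop (μ := volume)
      (s := fun n : ℕ => {x ∈ Metric.ball z ρ | (n : ℝ) < |w x|})
      (fun n => (hm n).nullMeasurableSet)
      (fun m n hmn x hx => ⟨hx.1, lt_of_le_of_lt (Nat.cast_le.2 hmn) hx.2⟩)
      ⟨0, measure_ne_top_of_subset (fun x hx => hx.1)
        (measure_ball_lt_top (x := z) (r := ρ)).ne⟩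
    have hempty : ⋂ n : ℕ, {x ∈ Metric.ball z ρ | (n : ℝ) < |w x|} = ∅ := by
      refine eq_empty_of_forall_notMem fun x hx => ?_
      obtain ⟨n, hn⟩ := exists_nat_ge |w x|
      exact absurd (mem_iInter.1 hx n).2 (not_lt.2 hn)
    rw [hempty, measure_empty] at h
    exact h
  obtain ⟨n, ⟨hn0, hnE⟩, hn1⟩ : ∃ n : ℕ, (volume {x ∈ Metric.ball z ρ | (n : ℝ) < |w x|} <
      volume (Metric.ball (0 : RN N) ρ) / 2 ∧ E / C ≤ (n : ℝ) ^ p₀) ∧ 1 ≤ n := by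
    refine ((hlev.eventually (gt_mem_nhds ?_)).and ?_ |>.and (eventually_ge_atTop 1)).exists
    · rw [hball ρ hρ0, ENNReal.ofReal_pos]
      positivity
    · exact ((tendsto_rpow_atTop hp₀).comp tendsto_natCast_atTop_atTop).eventually_ge_atTop _
  have hn1' : (1 : ℝ) ≤ n := by exact_mod_cast hn1
  refine ⟨n, hn1', fun k => ?_⟩
  induction k with
  | zero => simpa using hn0.le
  | succ k ih =>
    set y : ℝ := g ^ k with hy
    have hy0 : 0 < y := by positivity
    have hy1 : y ≤ 1 := pow_le_one₀ hg0.le hg1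
    have hL : 1 ≤ (n : ℝ) * 2 ^ k := one_le_mul_of_one_le_of_one_le hn1' (one_le_pow₀ one_le_two)
    have hstep := volume_superlevel_mul_le hsm hpm hw hρ (mul_pos hρ0 hy0)
      (mul_le_of_le_one_right hρ0.le hy1) hL hp₀.le hτ hp ih
    have hpow : (n : ℝ) * 2 ^ (k + 1) = 2 * (n * 2 ^ k) := by ring
    rw [hpow, pow_succ, ← hy, hball _ (by positivity)]
    rw [hball _ (by positivity), ENNReal.ofReal_rpow_of_pos (by positivity),
      ENNReal.ofReal_rpow_of_pos (by positivity), ← ENNReal.ofReal_div_of_pos (by positivity),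
      ← ENNReal.ofReal_mul (by positivity)] at hstep
    set X : ℝ := (n * 2 ^ k) ^ p₀ / (2 * (ρ * y)) ^ ((N : ℝ) + τ) * ((ρ * y) ^ N * V / 2) with hX
    have hX0 : 0 < X := by positivity
    have hid : (ρ * (y * g)) ^ N * V / 2 * X = n ^ p₀ * C := by
      have e1 : ((n : ℝ) * 2 ^ k) ^ p₀ = n ^ p₀ * y ^ (-((N : ℝ) - τ)) := by
        rw [Real.mul_rpow (by positivity) (by positivity), ← Real.rpow_natCast,
          ← Real.rpow_mul zero_le_two, mul_comm (k : ℝ), Real.rpow_mul zero_le_two, hgp,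
          ← Real.rpow_mul hg0.le, mul_comm _ (k : ℝ), Real.rpow_mul hg0.le, Real.rpow_natCast]
      have e2 : (2 * (ρ * y)) ^ ((N : ℝ) + τ) = (2 * ρ) ^ ((N : ℝ) + τ) * y ^ ((N : ℝ) + τ) := by
        rw [← Real.mul_rpow (by positivity) hy0.le]
        ring_nf
      have e3 : y ^ (-((N : ℝ) - τ)) * y ^ N * y ^ N = y ^ ((N : ℝ) + τ) := by
        rw [← Real.rpow_natCast, ← Real.rpow_add hy0, ← Real.rpow_add hy0]
        ring_nf
      have hy' : y ^ ((N : ℝ) + τ) ≠ 0 := (by positivity : 0 < y ^ ((N : ℝ) + τ)).ne'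
      calc (ρ * (y * g)) ^ N * V / 2 * X
          = n ^ p₀ * ((ρ * g) ^ N * ρ ^ N * (V / 2) ^ 2 / (2 * ρ) ^ ((N : ℝ) + τ)) *
            (y ^ (-((N : ℝ) - τ)) * y ^ N * y ^ N / y ^ ((N : ℝ) + τ)) := by
            rw [hX, e1, e2, mul_pow, mul_pow, mul_pow, mul_pow]
            field_simp
        _ = n ^ p₀ * C := by rw [e3, div_self hy', mul_one]
    have hEX : gmodular univ s p w 1 ≤
        ENNReal.ofReal ((ρ * (y * g)) ^ N * V / 2) * ENNReal.ofReal X := by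
      rw [← ENNReal.ofReal_mul (by positivity), hid, ← ENNReal.ofReal_toReal hE.ne]
      exact ENNReal.ofReal_le_ofReal ((div_le_iff₀ hC0).1 hnE)
    exact (ENNReal.mul_le_mul_iff_left (ENNReal.ofReal_pos.2 hX0).ne' ENNReal.ofReal_ne_top).1
      (hstep.trans hEX)

/-- Local fractional Sobolev inequality in the subcritical range. -/
lemma setLIntegral_rpow_lt_top (hsm : Measurable fun z : RN N × RN N => s z.1 z.2)
    (hpm : Measurable fun z : RN N × RN N => p z.1 z.2) {w : RN N → ℝ} (hw : Measurable w)
    {z : RN N} {ρ p₀ τ b : ℝ} (hρ0 : 0 < ρ) (hρ : ρ ≤ 1 / 2) (hp₀ : 0 < p₀) (hτ : 0 ≤ τ)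
    (hτN : τ < N)
    (hp : ∀ x ∈ Metric.ball z ρ, ∀ y ∈ Metric.ball z ρ, p₀ ≤ p x y ∧ τ ≤ s x y * p x y)
    (hE : gmodular univ s p w 1 < ⊤) (hb : 0 < b) (hbp : b * (N - τ) < N * p₀) :
    ∫⁻ x in Metric.ball z ρ, ENNReal.ofReal |w x| ^ b < ⊤ := by
  have hNτ : 0 < (N : ℝ) - τ := sub_pos.2 hτN
  have hN : 0 < N := by exact_mod_cast (hτ.trans_lt hτN)
  have : Nonempty (Fin N) := ⟨⟨0, hN⟩⟩
  obtain ⟨T, hT1, hT⟩ := exists_volume_superlevel_le hsm hpm hw hρ0 hρ hp₀ hτ hτN hp hE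
  have hT0 : 0 < T := by linarith
  set g : ℝ := (2 : ℝ) ^ (-(p₀ / (N - τ))) with hg
  have hg0 : 0 < g := by positivity
  set B := Metric.ball z ρ with hB
  have hBm : MeasurableSet B := Metric.isOpen_ball.measurableSet
  set A : ℕ → Set (RN N) := fun k => {x ∈ B | T * 2 ^ k < |w x|} with hA
  have hAm : ∀ k, MeasurableSet (A k) := fun k =>
    hBm.inter (measurableSet_lt measurable_const hw.norm)
  have hpt : ∀ x ∈ B, ENNReal.ofReal |w x| ^ b ≤ ENNReal.ofReal T ^ b +
      ∑' k, (A k).indicator (fun _ => ENNReal.ofReal (T * 2 ^ (k + 1)) ^ b) x := by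
    intro x hx
    have hex : ∃ k : ℕ, |w x| ≤ T * 2 ^ k := by
      obtain ⟨k, hk⟩ := pow_unbounded_of_one_lt |w x| one_lt_two
      exact ⟨k, hk.le.trans (le_mul_of_one_le_left (by positivity) hT1)⟩
    rcases Nat.eq_zero_or_eq_succ_pred (Nat.find hex) with h0 | hsucc
    · refine le_trans ?_ le_self_add
      have := Nat.find_spec hex
      rw [h0, pow_zero, mul_one] at this
      gcongr
    · refine le_trans ?_ le_add_self
      set k := (Nat.find hex).pred with hk
      have hle : |w x| ≤ T * 2 ^ (k + 1) := by
        have := Nat.find_spec hex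
        rwa [hsucc] at this
      have hlt : T * 2 ^ k < |w x| := not_le.1 (Nat.find_min hex (by omega))
      refine le_trans ?_ (ENNReal.le_tsum k)
      rw [indicator_of_mem (show x ∈ A k from ⟨hx, hlt⟩)]
      gcongr
  set V : ℝ≥0∞ := volume (Metric.ball (0 : RN N) 1) with hV
  have hVtop : V ≠ ⊤ := measure_ball_lt_top.ne
  have hterm : ∀ k, ENNReal.ofReal (T * 2 ^ (k + 1)) ^ b * volume (A k) ≤
      ENNReal.ofReal ((2 * T) ^ b * ρ ^ N) * V * ENNReal.ofReal (2 ^ b * g ^ N) ^ k := by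
    intro k
    have hgk : 0 < ρ * g ^ k := by positivity
    calc ENNReal.ofReal (T * 2 ^ (k + 1)) ^ b * volume (A k)
        ≤ ENNReal.ofReal (T * 2 ^ (k + 1)) ^ b * volume (Metric.ball (0 : RN N) (ρ * g ^ k)) := by
          exact mul_le_mul' le_rfl ((hT k).trans ENNReal.half_le_self)
      _ = ENNReal.ofReal ((2 * T) ^ b * ρ ^ N * (2 ^ b * g ^ N) ^ k) * V := by
          rw [Measure.addHaar_ball volume (0 : RN N) hgk.le, finrank_euclideanSpace_fin,
            ENNReal.ofReal_rpow_of_pos (by positivity), ← mul_assoc,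
            ← ENNReal.ofReal_mul (by positivity)]
          congr 2
          have e1 : (T * 2 ^ (k + 1)) ^ b = (2 * T) ^ b * (2 ^ b) ^ k := by
            rw [show T * 2 ^ (k + 1) = 2 * T * 2 ^ k by ring,
              Real.mul_rpow (by positivity) (by positivity), ← Real.rpow_natCast,
              ← Real.rpow_natCast, ← Real.rpow_mul zero_le_two, ← Real.rpow_mul zero_le_two,
              mul_comm b]
          rw [e1, mul_pow, mul_pow, ← pow_mul, ← pow_mul, mul_comm k N]
          ring
      _ = _ := by
          rw [ENNReal.ofReal_mul (by positivity), ENNReal.ofReal_pow (by positivity)]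
          ring
  have hratio : ENNReal.ofReal (2 ^ b * g ^ N) < 1 := by
    rw [ENNReal.ofReal_lt_one, hg, ← Real.rpow_natCast, ← Real.rpow_mul zero_le_two,
      ← Real.rpow_add two_pos]
    refine Real.rpow_lt_one_of_one_lt_of_neg one_lt_two ?_
    have : b < N * p₀ / (N - τ) := (lt_div_iff₀ hNτ).2 hbp
    have e : -(p₀ / (N - τ)) * (N : ℝ) = -(N * p₀ / (N - τ)) := by ring
    rw [e]
    linarith
  calc ∫⁻ x in B, ENNReal.ofReal |w x| ^ b
      ≤ ∫⁻ x in B, (ENNReal.ofReal T ^ b +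
          ∑' k, (A k).indicator (fun _ => ENNReal.ofReal (T * 2 ^ (k + 1)) ^ b) x) :=
        setLIntegral_mono' hBm hpt
    _ = ENNReal.ofReal T ^ b * volume B +
          ∑' k, ∫⁻ x in B, (A k).indicator (fun _ => ENNReal.ofReal (T * 2 ^ (k + 1)) ^ b) x := by
        rw [lintegral_add_left measurable_const, setLIntegral_const,
          lintegral_tsum fun k => (measurable_const.indicator (hAm k)).aemeasurable]
    _ ≤ ENNReal.ofReal T ^ b * volume B + ∑' k, ENNReal.ofReal ((2 * T) ^ b * ρ ^ N) * V *
          ENNReal.ofReal (2 ^ b * g ^ N) ^ k := by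
        gcongr with k
        refine (setLIntegral_le_lintegral _ _).trans ?_
        rw [lintegral_indicator_const (hAm k)]
        exact hterm k
    _ < ⊤ := by
        rw [ENNReal.tsum_mul_left, ENNReal.tsum_geometric]
        refine ENNReal.add_lt_top.2 ⟨ENNReal.mul_lt_top ?_ measure_ball_lt_top,
          ENNReal.mul_lt_top (ENNReal.mul_lt_top ENNReal.ofReal_lt_top hVtop.lt_top) ?_⟩
        · exact ENNReal.rpow_lt_top_of_nonneg hb.le ENNReal.ofReal_ne_top
        · exact ENNReal.inv_lt_top.2 (tsub_pos_of_lt hratio)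

/-- The subcritical embedding of `X₀` into the variable exponent Lebesgue space. -/
lemma lintegral_rpow_lt_top_of_gmodular (hs : S1 s) (hp : P1 s p) {Ω : Set (RN N)}
    (hΩb : Bornology.IsBounded Ω) {β : RN N → ℝ} (hβ : ContinuousOn β (closure Ω))
    (hβ1 : ∀ x ∈ closure Ω, p x x ≤ β x) (hβ2 : ∀ x ∈ closure Ω, β x < pstar s p x)
    (hΩ : MeasurableSet Ω) {w : RN N → ℝ} (hw : Measurable w)
    (hE : gmodular univ s p w 1 < ⊤) :
    ∫⁻ x in Ω, ENNReal.ofReal |w x| ^ β x < ⊤ := by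
  obtain ⟨hsc, -, hsb, hs0, hs1⟩ := hs
  obtain ⟨⟨hpc, hp1, hpb⟩, -, hspN⟩ := hp
  have hspos : ∀ x y, 0 < s x y := fun x y => hs0.trans_le (inf2_le hs0 x y)
  have hppos : ∀ x y, 0 < p x y := fun x y =>
    (one_pos.trans hp1).trans_le (inf2_le (one_pos.trans hp1) x y)
  suffices h : ∫⁻ x in closure Ω ∩ Ω, ENNReal.ofReal |w x| ^ β x < ⊤ by
    rwa [inter_eq_self_of_subset_right subset_closure] at h
  refine hΩb.isCompact_closure.induction_on
    (p := fun S => ∫⁻ x in S ∩ Ω, ENNReal.ofReal |w x| ^ β x < ⊤) (by simp) ?_ ?_ ?_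
  · exact fun S T hST hT => (lintegral_mono_set (inter_subset_inter_left Ω hST)).trans_lt hT
  · intro S T hS hT
    rw [union_inter_distrib_right]
    exact (lintegral_union_le _ _ _).trans_lt (ENNReal.add_lt_top.2 ⟨hS, hT⟩)
  · intro z hz
    have hSP0 : 0 < s z z * p z z := mul_pos (hspos z z) (hppos z z)
    have hSPN : s z z * p z z < N :=
      (mul_le_mul (le_sup2 hsb z z) (le_sup2 hpb z z) (hppos z z).le
        ((hspos z z).le.trans (le_sup2 hsb z z))).trans_lt hspN
    have hcrit : β z * (N - s z z * p z z) < N * p z z :=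
      (lt_div_iff₀ (sub_pos.2 hSPN)).1 (hβ2 z hz)
    obtain ⟨e, ⟨he, heP, heSP⟩, he0⟩ : ∃ e : ℝ,
        ((β z + e) * (N - (s z z * p z z - e)) < N * (p z z - e) ∧ e < p z z ∧
          e < s z z * p z z) ∧ 0 < e := by
      have h1 : ∀ᶠ e : ℝ in nhds 0,
          (β z + e) * (N - (s z z * p z z - e)) < N * (p z z - e) :=
        ContinuousAt.eventually_lt (by fun_prop) (by fun_prop) (by simpa using hcrit)
      have h2 : ∀ᶠ e : ℝ in nhdsWithin 0 (Ioi 0), _ :=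
        nhdsWithin_le_nhds (h1.and ((gt_mem_nhds (hppos z z)).and (gt_mem_nhds hSP0)))
      exact (h2.and self_mem_nhdsWithin).exists
    have hcont : ∀ᶠ q : RN N × RN N in nhds (z, z),
        p z z - e < p q.1 q.2 ∧ s z z * p z z - e < s q.1 q.2 * p q.1 q.2 :=
      (hpc.continuousAt.eventually (lt_mem_nhds (by simpa using he0))).and
        ((hsc.mul hpc).continuousAt.eventually (lt_mem_nhds (by simpa using he0)))
    obtain ⟨ρ₁, hρ₁, h₁⟩ := Metric.eventually_nhds_iff_ball.1 hcont
    have hβev : ∀ᶠ x in nhdsWithin z (closure Ω), β x < β z + e :=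
      (hβ z hz).eventually (gt_mem_nhds (by linarith))
    obtain ⟨ρ₂, hρ₂, h₂⟩ := Metric.mem_nhdsWithin_iff.1 hβev
    set ρ := min (1 / 2) (min ρ₁ ρ₂) with hρ
    have hρ0 : 0 < ρ := lt_min (by norm_num) (lt_min hρ₁ hρ₂)
    have hρρ₁ : ρ ≤ ρ₁ := (min_le_right _ _).trans (min_le_left _ _)
    have hρρ₂ : ρ ≤ ρ₂ := (min_le_right _ _).trans (min_le_right _ _)
    have hβz : 0 < β z := (hppos z z).trans_le (hβ1 z hz)
    refine ⟨Metric.ball z ρ, mem_nhdsWithin_of_mem_nhds (Metric.ball_mem_nhds z hρ0), ?_⟩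
    have hpball : ∀ x ∈ Metric.ball z ρ, ∀ y ∈ Metric.ball z ρ,
        p z z - e ≤ p x y ∧ s z z * p z z - e ≤ s x y * p x y := by
      intro x hx y hy
      have := h₁ (x, y) (by
        rw [← ball_prod_same]
        exact ⟨Metric.ball_subset_ball hρρ₁ hx, Metric.ball_subset_ball hρρ₁ hy⟩)
      exact ⟨this.1.le, this.2.le⟩
    have hint : ∫⁻ x in Metric.ball z ρ, ENNReal.ofReal |w x| ^ (β z + e) < ⊤ :=
      setLIntegral_rpow_lt_top hsc.measurable hpc.measurable hw hρ0 (min_le_left _ _)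
        (by linarith) (by linarith) (by linarith) hpball hE (by linarith) he
    have hBm : MeasurableSet (Metric.ball z ρ) := Metric.isOpen_ball.measurableSet
    calc ∫⁻ x in Metric.ball z ρ ∩ Ω, ENNReal.ofReal |w x| ^ β x
        ≤ ∫⁻ x in Metric.ball z ρ ∩ Ω, (1 + ENNReal.ofReal |w x| ^ (β z + e)) := by
          refine setLIntegral_mono' (hBm.inter hΩ) fun x hx => ?_
          have hxc : x ∈ closure Ω := subset_closure hx.2
          rcases le_total (ENNReal.ofReal |w x|) 1 with h | h
          · exact (ENNReal.rpow_le_one h ((hppos x x).le.trans (hβ1 x hxc))).trans le_self_add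
          · refine le_trans (ENNReal.rpow_le_rpow_of_exponent_le h ?_) le_add_self
            exact (h₂ ⟨Metric.ball_subset_ball hρρ₂ hx.1, hxc⟩ : β x < β z + e).le
      _ ≤ ∫⁻ x in Metric.ball z ρ, (1 + ENNReal.ofReal |w x| ^ (β z + e)) :=
          lintegral_mono_set inter_subset_left
      _ < ⊤ := by
          rw [lintegral_add_left measurable_const, setLIntegral_one]
          exact ENNReal.add_lt_top.2 ⟨measure_ball_lt_top, hint⟩

lemma memX0_of_gmodular_lt_top (hs : S1 s) (hp : P1 s p) {Ω : Set (RN N)}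
    (hΩb : Bornology.IsBounded Ω) {β : RN N → ℝ} (hβ : ContinuousOn β (closure Ω))
    (hβ1 : ∀ x ∈ closure Ω, p x x ≤ β x) (hβ2 : ∀ x ∈ closure Ω, β x < pstar s p x)
    (hΩ : MeasurableSet Ω) {u : RN N → ℝ} (hu : Measurable u)
    (hu0 : ∀ᵐ x, x ∉ Ω → u x = 0) {l : ℝ} (hl : 0 < l) (hE : gmodular univ s p u l < ⊤) :
    MemX0 Ω s p β u := by
  refine ⟨hu, ⟨hu, l, hl, ?_⟩, ⟨l, hl, (lintegral_mono_set (subset_univ _)).trans_lt hE⟩, hu0⟩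
  have hscale : gmodular univ s p (fun x => u x / l) 1 = gmodular univ s p u l := by
    unfold gmodular
    congr 1
    ext z
    rw [← sub_div, abs_div, abs_of_pos hl, div_one]
  have := lintegral_rpow_lt_top_of_gmodular hs hp hΩb hβ hβ1 hβ2 hΩ (hu.div_const l)
    (hscale.trans_lt hE)
  unfold lmodular
  simpa only [abs_div, abs_of_pos hl] using this

end Gagliardo

/-- `(X₀, ‖·‖_{X₀})` is complete and uniformly convex (Proposition reflx). -/
theorem statement8 {N : ℕ} (hN : 2 ≤ N) (Ω : Set (RN N))
    (hΩo : IsOpen Ω) (hΩb : Bornology.IsBounded Ω) (hΩne : Ω.Nonempty)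
    (s p : RN N → RN N → ℝ) (β : RN N → ℝ)
    (hs : S1 s) (hp : P1 s p)
    (hβ : CPlusOn (closure Ω) β) (hβ1 : ∀ x ∈ closure Ω, p x x ≤ β x)
    (hβ2 : ∀ x ∈ closure Ω, β x < pstar s p x) :
    (∀ u : ℕ → RN N → ℝ, (∀ m, MemX0 Ω s p β (u m)) →
      (∀ ε : ℝ, 0 < ε → ∃ M₀ : ℕ, ∀ m n : ℕ, M₀ ≤ m → M₀ ≤ n →
        x0Norm s p (fun x => u m x - u n x) < ε) →
      ∃ v : RN N → ℝ, MemX0 Ω s p β v ∧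
        Tendsto (fun m => x0Norm s p (fun x => u m x - v x)) atTop (nhds 0)) ∧
    (∀ ε : ℝ, 0 < ε → ε ≤ 2 → ∃ δ : ℝ, 0 < δ ∧
      ∀ u v : RN N → ℝ, MemX0 Ω s p β u → MemX0 Ω s p β v →
        x0Norm s p u ≤ 1 → x0Norm s p v ≤ 1 →
        ε ≤ x0Norm s p (fun x => u x - v x) →
        x0Norm s p (fun x => (u x + v x) / 2) ≤ 1 - δ) := by
  have hsm : Measurable fun z : RN N × RN N => s z.1 z.2 := hs.1.measurable
  have hpm : Measurable fun z : RN N × RN N => p z.1 z.2 := hp.1.1.measurable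
  have hs01 : ∀ x y, 0 ≤ s x y ∧ s x y ≤ 1 := fun x y =>
    ⟨hs.2.2.2.1.le.trans (inf2_le hs.2.2.2.1 x y),
      (le_sup2 hs.2.2.1 x y).trans hs.2.2.2.2.le⟩
  have hq : 1 < inf2 p := hp.1.2.1
  have hpI : ∀ z : RN N × RN N, p z.1 z.2 ∈ Icc (inf2 p) (sup2 p) := fun z =>
    ⟨inf2_le (one_pos.trans hq) _ _, le_sup2 hp.1.2.2 _ _⟩
  have hp1 : ∀ z : RN N × RN N, 1 ≤ p z.1 z.2 := fun z => hq.le.trans (hpI z).1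
  have hΩm : MeasurableSet Ω := hΩo.measurableSet
  set ν := gagliardoMeasure s p with hν
  set r : RN N × RN N → ℝ := fun z => p z.1 z.2 with hr
  set G : (RN N → ℝ) → RN N × RN N → ℝ := fun u z => u z.1 - u z.2 with hG
  have hGm : ∀ {u : RN N → ℝ}, Measurable u → Measurable (G u) := fun hu =>
    (hu.comp measurable_fst).sub (hu.comp measurable_snd)
  have hGsub : ∀ u v : RN N → ℝ, G (fun x => u x - v x) = fun z => G u z - G v z := by
    intro u v
    ext z
    simp only [hG]
    ring
  have hfin : ∀ {u : RN N → ℝ}, MemX0 Ω s p β u →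
      ∃ l, 0 < l ∧ varModular ν r (fun z => G u z / l) < ⊤ := by
    rintro u ⟨hu, -, ⟨l, hl, hlt⟩, hu0⟩
    refine ⟨l, hl, ?_⟩
    rw [← gmodular_univ_eq hsm hpm hu hl]
    exact (gmodular_univ_le_Qset (fun x y => one_pos.trans_le (hp1 (x, y))) hΩm hu0 l).trans_lt hlt
  constructor
  · intro u hu hcau
    have hum : ∀ m, Measurable (u m) := fun m => (hu m).1
    have hsubm : ∀ m n, Measurable fun x => u m x - u n x := fun m n => (hum m).sub (hum n)
    have hcau' : ∀ ε : ℝ, 0 < ε → ∃ M₀ : ℕ, ∀ m n : ℕ, M₀ ≤ m → M₀ ≤ n →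
        varModular ν r (fun z => G (fun x => u m x - u n x) z / ε) < 1 := by
      intro ε hε
      obtain ⟨M₀, hM⟩ := hcau ε hε
      refine ⟨M₀, fun m n hm hn => ?_⟩
      refine varModular_lt_one_of_varLux_lt hp1 ?_ ?_
      · rw [hGsub]
        exact exists_varModular_div_sub_lt_top hq hpm hpI (hGm (hum m)) (hGm (hum n))
          (hfin (hu m)) (hfin (hu n))
      · rw [← x0Norm_eq hsm hpm (hsubm m n)]
        exact hM m n hm hn
    obtain ⟨C, hC, hpoin⟩ := exists_lintegral_le_gmodular (s := s) (p := p) (P := sup2 p)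
      (by omega : 0 < N) hs01 (fun x y => ⟨hp1 (x, y), (hpI (x, y)).2⟩) hΩm hΩb
    obtain ⟨φ, hφ, hφc⟩ := extraction_forall_of_eventually
      (P := fun k j => ∀ m n : ℕ, j ≤ m → j ≤ n →
        varModular ν r (fun z => G (fun x => u m x - u n x) z / (1 / 2) ^ k) < 1) (fun k => by
        obtain ⟨M₀, hM⟩ := hcau' ((1 / 2) ^ k) (by positivity)
        filter_upwards [eventually_ge_atTop M₀] with j hj m n hm hn
        exact hM m n (hj.trans hm) (hj.trans hn))
    have hconv : ∀ᵐ x, ∃ l : ℝ, Tendsto (fun k => u (φ k) x) atTop (nhds l) := by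
      refine Lp.ae_tendsto_of_cauchy_eLpNorm (p := 1)
        (B := fun k => ENNReal.ofReal ((1 / 2) ^ k) * (C + 1))
        (fun k => (hum (φ k)).aestronglyMeasurable) le_rfl ?_ ?_
      · rw [ENNReal.tsum_mul_right]
        refine ENNReal.mul_ne_top ?_ (ENNReal.add_ne_top.2 ⟨hC, ENNReal.one_ne_top⟩)
        exact (summable_geometric_of_lt_one (by norm_num) (by norm_num)).tsum_ofReal_ne_top
      · intro k m n hm hn
        have h0 : ∀ᵐ x, x ∉ Ω → u (φ m) x - u (φ n) x = 0 := by
          filter_upwards [(hu (φ m)).2.2.2, (hu (φ n)).2.2.2] with x h1 h2 hx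
          rw [h1 hx, h2 hx, _root_.sub_zero]
        have hk : (0 : ℝ) < (1 / 2) ^ k := by positivity
        have hg : gmodular univ s p (fun x => u (φ m) x - u (φ n) x) ((1 / 2) ^ k) ≤ 1 := by
          rw [gmodular_univ_eq hsm hpm (hsubm _ _) hk]
          exact (hφc k _ _ (hφ.monotone hm) (hφ.monotone hn)).le
        have hle := hpoin _ (hsubm _ _) h0 _ hk hg
        rw [eLpNorm_one_eq_lintegral_enorm]
        calc ∫⁻ x, ‖(u (φ m) - u (φ n)) x‖ₑ
            = ∫⁻ x, ENNReal.ofReal |u (φ m) x - u (φ n) x| := by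
              simp only [Real.enorm_eq_ofReal_abs, Pi.sub_apply]
          _ ≤ ENNReal.ofReal ((1 / 2) ^ k) * C := hle
          _ < ENNReal.ofReal ((1 / 2) ^ k) * (C + 1) := by
              refine ENNReal.mul_lt_mul_right ?_ ENNReal.ofReal_ne_top
                (ENNReal.lt_add_right hC one_ne_zero)
              exact (ENNReal.ofReal_pos.2 hk).ne'
    obtain ⟨v, hvm, hv⟩ := measurable_limit_of_tendsto_metrizable_ae
      (fun k => (hum (φ k)).aemeasurable) hconv
    have hv0 : ∀ᵐ x, x ∉ Ω → v x = 0 := by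
      filter_upwards [hv, ae_all_iff.2 fun k => (hu (φ k)).2.2.2] with x hx h0 hxΩ
      refine tendsto_nhds_unique hx ?_
      simp only [h0 _ hxΩ]
      exact tendsto_const_nhds
    have hfatou : ∀ ε : ℝ, 0 < ε → ∃ M₀ : ℕ, ∀ m : ℕ, M₀ ≤ m →
        varModular ν r (fun z => G (fun x => u m x - v x) z / ε) ≤ 1 := by
      intro ε hε
      obtain ⟨M₀, hM⟩ := hcau' ε hε
      refine ⟨M₀, fun m hm => varModular_le_of_tendsto hpm
        (F := fun k z => G (fun x => u m x - u (φ k) x) z / ε)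
        (fun k => (hGm (hsubm _ _)).div_const ε) ?_ ?_⟩
      · refine (withDensity_absolutelyContinuous _ _).ae_le ?_
        have h1 := (Measure.quasiMeasurePreserving_fst (μ := (volume : Measure (RN N)))
          (ν := (volume : Measure (RN N)))).ae hv
        have h2 := (Measure.quasiMeasurePreserving_snd (μ := (volume : Measure (RN N)))
          (ν := (volume : Measure (RN N)))).ae hv
        filter_upwards [h1, h2] with z h1 h2
        exact ((tendsto_const_nhds.sub h1).sub (tendsto_const_nhds.sub h2)).div_const ε
      · filter_upwards [eventually_ge_atTop M₀] with k hk
        exact (hM m (φ k) hm (hk.trans (hφ.id_le k))).le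
    have hdiffm : ∀ m, Measurable fun x => u m x - v x := fun m => (hum m).sub hvm
    refine ⟨v, ?_, ?_⟩
    · obtain ⟨M₀, hM⟩ := hfatou 1 one_pos
      obtain ⟨l, hl, hlt⟩ := exists_varModular_div_sub_lt_top hq hpm hpI (hGm (hum M₀))
        (hGm (hdiffm M₀)) (hfin (hu M₀)) ⟨1, one_pos, (hM M₀ le_rfl).trans_lt ENNReal.one_lt_top⟩
      refine memX0_of_gmodular_lt_top hs hp hΩb hβ.1 hβ1 hβ2 hΩm hvm hv0 hl ?_
      rw [gmodular_univ_eq hsm hpm hvm hl]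
      simpa only [hGsub, _root_.sub_sub_cancel] using hlt
    · rw [Metric.tendsto_atTop]
      intro ε hε
      obtain ⟨M₀, hM⟩ := hfatou (ε / 4) (by positivity)
      refine ⟨M₀, fun m hm => ?_⟩
      have hle : x0Norm s p (fun x => u m x - v x) ≤ ε / 2 := by
        rw [x0Norm_eq hsm hpm (hdiffm m)]
        refine varLux_le (half_pos hε) ?_
        calc varModular ν r (fun z => G (fun x => u m x - v x) z / (ε / 2))
            ≤ ENNReal.ofReal (ε / 4 / (ε / 2)) *
              varModular ν r (fun z => G (fun x => u m x - v x) z / (ε / 4)) :=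
              varModular_div_le hp1 (by positivity) (by linarith)
          _ ≤ ENNReal.ofReal (ε / 4 / (ε / 2)) * 1 := by
              gcongr
              exact hM m hm
          _ < 1 := by
              rw [mul_one, ENNReal.ofReal_lt_one, div_lt_one (by positivity)]
              linarith
      have hnn : 0 ≤ x0Norm s p (fun x => u m x - v x) := by
        rw [x0Norm_eq hsm hpm (hdiffm m)]
        exact varLux_nonneg _
      rw [Real.dist_eq, _root_.sub_zero, abs_of_nonneg hnn]
      linarith
  · intro ε hε _
    obtain ⟨δ, hδ, h⟩ := exists_varLux_midpoint_le (ν := ν) hq hε hpm hpI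
    refine ⟨δ, hδ, fun u v hu hv hu1 hv1 huv => ?_⟩
    rw [x0Norm_eq hsm hpm hu.1] at hu1
    rw [x0Norm_eq hsm hpm hv.1] at hv1
    rw [x0Norm_eq hsm hpm (u := fun x => u x - v x) (hu.1.sub hv.1)] at huv
    rw [x0Norm_eq hsm hpm (u := fun x => (u x + v x) / 2) ((hu.1.add hv.1).div_const 2)]
    have hmid : (fun z : RN N × RN N => (u z.1 + v z.1) / 2 - (u z.2 + v z.2) / 2) =
        fun z => (G u z + G v z) / 2 := by
      ext z
      simp only [hG]
      ring
    rw [hmid]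
    refine h (G u) (G v) (hGm hu.1) (hGm hv.1) (hfin hu) (hfin hv) hu1 hv1 ?_
    exact huv.trans_eq (congrArg (varLux ν r) (hGsub u v))

end VarOrderChoquard
end
end

section
/- Let Ω ⊂ ℝ^N be a bounded open set, let ν₁ ∈ L^∞(Ω) with ν₁ ≥ 0 and ν₁ ≢ 0, and let ν₂ : Ω → ℝ be measurable with ν₁(x)ν₂(x) ≥ 1 a.e. in Ω. Then for every u ∈ L^{ν₁(x)ν₂(x)}(Ω), ‖|u|^{ν₁(·)}‖_{L^{ν₂(x)}(Ω)} ≤ ‖u‖_{L^{ν₁(x)ν₂(x)}(Ω)}^{ν₁⁻} + ‖u‖_{L^{ν₁(x)ν₂(x)}(Ω)}^{ν₁⁺}. -/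
open MeasureTheory Set Filter ENNReal

noncomputable section

namespace VarOrderChoquard

variable {N : ℕ}

/-- If the exponent is a.e. at least `1`, a function with finite modular at some scale has modular
at most `1` at a larger scale. -/
theorem exists_lmodular_le_one {U : Set (RN N)} {γ u : RN N → ℝ}
    (hγ : ∀ᵐ x ∂volume.restrict U, 1 ≤ γ x) {l : ℝ} (hl : 0 < l) (hfin : lmodular U γ u l < ⊤) :
    ∃ l', 0 < l' ∧ lmodular U γ u l' ≤ 1 := by
  set M := lmodular U γ u l with hM
  set K : ℝ := max 1 M.toReal
  have hK1 : 1 ≤ K := le_max_left _ _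
  have hK : 0 < K := by positivity
  refine ⟨l * K, by positivity, ?_⟩
  have hc : lmodular U γ u (l * K) ≤ ENNReal.ofReal K⁻¹ * M := by
    rw [hM, lmodular, lmodular, ← lintegral_const_mul' _ _ ofReal_ne_top]
    refine lintegral_mono_ae ?_
    filter_upwards [hγ] with x hx
    have hx0 : 0 ≤ γ x := by linarith
    rw [ofReal_rpow_of_nonneg (by positivity) hx0, ofReal_rpow_of_nonneg (by positivity) hx0,
      ← ofReal_mul (by positivity)]
    refine ofReal_le_ofReal ?_
    rw [show |u x| / (l * K) = K⁻¹ * (|u x| / l) by field_simp,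
      Real.mul_rpow (by positivity) (by positivity)]
    refine mul_le_mul_of_nonneg_right ?_ (by positivity)
    simpa using Real.rpow_le_rpow_of_exponent_ge (inv_pos.2 hK) (inv_le_one_of_one_le₀ hK1) hx
  refine hc.trans ?_
  rw [← ofReal_toReal hfin.ne, ← ofReal_mul (by positivity), ofReal_le_one,
    inv_mul_le_one₀ hK]
  exact le_max_right _ _

/-- The modular of `|u|^ν₁` with exponent `ν₂` at scale `t` is at most that of `u` with exponent
`ν₁ν₂` at scale `l` as soon as `l ^ ν₁ ≤ t` a.e. -/
theorem lmodular_abs_rpow_le {U : Set (RN N)} {ν₁ ν₂ u : RN N → ℝ} {l t : ℝ} (hl : 0 < l)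
    (hν₂ : ∀ᵐ x ∂volume.restrict U, 0 ≤ ν₂ x)
    (hγ : ∀ᵐ x ∂volume.restrict U, 0 ≤ ν₁ x * ν₂ x)
    (ht : ∀ᵐ x ∂volume.restrict U, l ^ ν₁ x ≤ t) :
    lmodular U ν₂ (fun x => |u x| ^ ν₁ x) t ≤ lmodular U (fun x => ν₁ x * ν₂ x) u l := by
  refine lintegral_mono_ae ?_
  filter_upwards [hν₂, hγ, ht] with x hx hxγ hxt
  have hlν : 0 < l ^ ν₁ x := Real.rpow_pos_of_pos hl _
  rw [abs_of_nonneg (by positivity), ofReal_rpow_of_nonneg (by positivity) hxγ,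
    Real.rpow_mul (by positivity), Real.div_rpow (abs_nonneg _) hl.le,
    ← ofReal_rpow_of_nonneg (by positivity) hx]
  gcongr

/-- Comparison of a power with the extremal powers on a set where the exponent is bounded. -/
theorem rpow_le_rpow_infOn_add_rpow_supOn {D : Set (RN N)} {g : RN N → ℝ}
    (hb : BddBelow (g '' D)) (ha : BddAbove (g '' D)) {l : ℝ} (hl : 0 < l) {x : RN N}
    (hx : x ∈ D) : l ^ g x ≤ l ^ infOn D g + l ^ supOn D g := by
  have h1 : infOn D g ≤ g x := csInf_le hb (mem_image_of_mem g hx)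
  have h2 : g x ≤ supOn D g := le_csSup ha (mem_image_of_mem g hx)
  rcases le_total l 1 with h | h
  · exact (Real.rpow_le_rpow_of_exponent_ge hl h h1).trans
      (le_add_of_nonneg_right (Real.rpow_nonneg hl.le _))
  · exact (Real.rpow_le_rpow_of_exponent_le h h2).trans
      (le_add_of_nonneg_left (Real.rpow_nonneg hl.le _))

/-- Lemma A.1 of García-Huidobro et al. for variable-exponent Lebesgue
spaces. -/
theorem statement11 {N : ℕ} (Ω : Set (RN N))
    (hΩo : IsOpen Ω) (hΩb : Bornology.IsBounded Ω)
    (ν₁ ν₂ : RN N → ℝ) (hν₁m : Measurable ν₁)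
    (hν₁b : ∃ C : ℝ, ∀ x ∈ Ω, ν₁ x ≤ C)
    (hν₁0 : ∀ x ∈ Ω, 0 ≤ ν₁ x)
    (hν₁ne : ¬ (∀ᵐ x, x ∈ Ω → ν₁ x = 0))
    (hν₂m : Measurable ν₂)
    (h12 : ∀ᵐ x, x ∈ Ω → 1 ≤ ν₁ x * ν₂ x)
    (u : RN N → ℝ) (hu : MemVarLp Ω (fun x => ν₁ x * ν₂ x) u) :
    luxNorm Ω ν₂ (fun x => |u x| ^ ν₁ x) ≤
      luxNorm Ω (fun x => ν₁ x * ν₂ x) u ^ infOn Ω ν₁ +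
        luxNorm Ω (fun x => ν₁ x * ν₂ x) u ^ supOn Ω ν₁ := by
  have hγ : ∀ᵐ x ∂volume.restrict Ω, 1 ≤ ν₁ x * ν₂ x :=
    (ae_restrict_iff' hΩo.measurableSet).2 h12
  have hmem : ∀ᵐ x ∂volume.restrict Ω, x ∈ Ω := ae_restrict_mem hΩo.measurableSet
  have hν₂ : ∀ᵐ x ∂volume.restrict Ω, 0 ≤ ν₂ x := by
    filter_upwards [hγ, hmem] with x hx hxΩ
    exact (pos_of_mul_pos_right (one_pos.trans_le hx) (hν₁0 x hxΩ)).le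
  have hb : BddBelow (ν₁ '' Ω) := ⟨0, forall_mem_image.2 hν₁0⟩
  have ha : BddAbove (ν₁ '' Ω) := hν₁b.imp fun C hC => forall_mem_image.2 hC
  have hinf : 0 ≤ infOn Ω ν₁ := Real.sInf_nonneg (forall_mem_image.2 hν₁0)
  have hsup : 0 ≤ supOn Ω ν₁ := Real.sSup_nonneg (forall_mem_image.2 hν₁0)
  obtain ⟨-, l₀, hl₀, hfin⟩ := hu
  obtain ⟨l, -, hl, hlmem⟩ := exists_seq_tendsto_sInf
    (exists_lmodular_le_one hγ hl₀ hfin) ⟨0, fun _ h => h.1.le⟩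
  refine ge_of_tendsto' ((hl.rpow_const (Or.inr hinf)).add (hl.rpow_const (Or.inr hsup)))
    fun n => ?_
  obtain ⟨hpos, hle⟩ := hlmem n
  refine csInf_le ⟨0, fun _ h => h.1.le⟩ ⟨by positivity, le_trans ?_ hle⟩
  refine lmodular_abs_rpow_le hpos hν₂ (hγ.mono fun x hx => zero_le_one.trans hx) ?_
  filter_upwards [hmem] with x hx
  exact rpow_le_rpow_infOn_add_rpow_supOn hb ha hpos hx

end VarOrderChoquard
end
end
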